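/- arXiv:1112.5747 — 2 statements merged into one kernel-verified Lean document; each statement's English description precedes it below -/
import Mathlib

section
/- Assume X is a Markov chain with transition kernel K ∈ D(G), and X_0 has distribution H_0 on [0,∞) with regularly varying tail: t·H_0(b(t)·) → ν_α vaguely in M_+((0,∞]) as t → ∞, for some scaling function b(t) → ∞ and some α > 0, where ν_α(x,∞] = x^{-α}. Suppose that either G({0}) = 0, or γ ≡ 0 is an extremal boundary for K, or K satisfies the regularity condition. Then for every m ≥ 1, as t → ∞, t·P[(X_0/b(t), X_1/b(t), …, X_m/b(t)) ∈ ·] converges vaguely in M_+(E_m), where E_m = (0,∞] × [0,∞]^m, to the measure ν* given by ν*(dx_0, dx_1…dx_m) = ν_α(dx_0)·P_{x_0}[(T*_1, …, T*_m) ∈ d(x_1,…,x_m)]. -/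
open MeasureTheory ProbabilityTheory Filter Topology
open scoped NNReal ENNReal

noncomputable section

/-- `K ∈ D(G)`: the transition kernel `K` is in the domain of attraction of `G`, i.e.
`K(t, t·)` converges weakly to `G` on the compactified half-line `[0,∞]` as `t → ∞`. -/
def KernelDOA (K : Kernel ℝ≥0 ℝ≥0) (G : Measure ℝ≥0) : Prop :=
  ∀ f : C(ℝ≥0∞, ℝ),
    Tendsto (fun t : ℝ≥0 => ∫ x, f ((x / t : ℝ≥0) : ℝ≥0∞) ∂(K t))
      atTop (𝓝 (∫ x, f (x : ℝ≥0∞) ∂G))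

/-- An extremal boundary for `K` (relative to `G`): `γ(t) → 0` and
`K(t, t[0,γ(t)]) → G({0})` as `t → ∞`. -/
def ExtremalBoundary (K : Kernel ℝ≥0 ℝ≥0) (G : Measure ℝ≥0) (γ : ℝ≥0 → ℝ≥0) : Prop :=
  Tendsto γ atTop (𝓝 0) ∧
    Tendsto (fun t : ℝ≥0 => (K t) (Set.Iic (t * γ t))) atTop (𝓝 (G {0}))

/-- The regularity condition: `K(t u_t, t·)` converges weakly on `[0,∞]` to the point
mass `δ_0` as `t → ∞`, for every nonnegative function `u_t → 0`. -/
def RegCond (K : Kernel ℝ≥0 ℝ≥0) : Prop :=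
  ∀ u : ℝ≥0 → ℝ≥0, Tendsto u atTop (𝓝 0) →
    ∀ f : C(ℝ≥0∞, ℝ),
      Tendsto (fun t : ℝ≥0 => ∫ x, f ((x / t : ℝ≥0) : ℝ≥0∞) ∂(K (t * u t)))
        atTop (𝓝 (f 0))

/-- The law of `(X_1, …, X_m)` for the Markov chain with transition kernel `K`
started from `X_0 = y`. -/
def jointLaw (K : Kernel ℝ≥0 ℝ≥0) : (m : ℕ) → ℝ≥0 → Measure (Fin m → ℝ≥0)
  | 0, _ => Measure.dirac (fun i => i.elim0)
  | m + 1, y => (K y).bind (fun x1 => (jointLaw K m x1).map (Fin.cons x1))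

/-- The law of `(X_0, X_1, …, X_m)` for the Markov chain with kernel `K` and initial
distribution `H0`. -/
def jointLaw0 (K : Kernel ℝ≥0 ℝ≥0) (m : ℕ) (H0 : Measure ℝ≥0) :
    Measure (Fin (m + 1) → ℝ≥0) :=
  H0.bind (fun x0 => (jointLaw K m x0).map (Fin.cons x0))

/-- The law of `(T*_1, …, T*_m)` for the tail chain associated with `(G, δ_0)` started
from `T*_0 = x0 ∈ (0,∞]`, as a measure on `[0,∞]^m`. -/
def tailChainLawE (G : Measure ℝ≥0) [IsProbabilityMeasure G] (m : ℕ) (x0 : ℝ≥0∞) :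
    Measure (Fin m → ℝ≥0∞) :=
  (Measure.pi fun _ : Fin m => G).map
    (fun ξ (i : Fin m) => x0 * ∏ j ∈ Finset.Iic i, (ξ j : ℝ≥0∞))

/-- The limit measure `ν*(dx_0, dx) = ν_α(dx_0) P_{x_0}[(T*_1,…,T*_m) ∈ dx]` on
`E_m = (0,∞] × [0,∞]^m`. -/
def nuStar (G : Measure ℝ≥0) [IsProbabilityMeasure G] (m : ℕ) (να : Measure ℝ≥0∞) :
    Measure (Fin (m + 1) → ℝ≥0∞) :=
  να.bind (fun x0 => (tailChainLawE G m x0).map (Fin.cons x0))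

/-- The kernel `x ↦ (J x).map (Fin.cons x)`, prepending the starting point to a path. -/
def consKernel {α : Type*} [MeasurableSpace α] {m : ℕ} (J : Kernel α (Fin m → α)) :
    Kernel α (Fin (m + 1) → α) :=
  (Kernel.id ×ₖ J).map (fun p => Fin.cons p.1 p.2)

lemma measurable_finCons {α : Type*} [MeasurableSpace α] {m : ℕ} :
    Measurable (fun p : α × (Fin m → α) => (Fin.cons p.1 p.2 : Fin (m + 1) → α)) := by
  refine measurable_pi_iff.2 fun i => ?_
  refine Fin.cases ?_ (fun j => ?_) i
  · simpa using measurable_fst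
  · simpa [Function.comp_def] using (measurable_pi_apply j).comp measurable_snd

lemma consKernel_apply {α : Type*} [MeasurableSpace α] {m : ℕ} (J : Kernel α (Fin m → α))
    [IsSFiniteKernel J] (x : α) : consKernel J x = (J x).map (Fin.cons x) := by
  rw [consKernel, Kernel.map_apply _ measurable_finCons, Kernel.prod_apply, Kernel.id_apply,
    Measure.dirac_prod, Measure.map_map measurable_finCons measurable_prodMk_left]
  rfl

instance {α : Type*} [MeasurableSpace α] {m : ℕ} (J : Kernel α (Fin m → α))
    [IsMarkovKernel J] : IsMarkovKernel (consKernel J) :=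
  Kernel.IsMarkovKernel.map _ measurable_finCons

/-- `jointLaw` as a Markov kernel in the starting point. -/
def jointKernel (K : Kernel ℝ≥0 ℝ≥0) : (m : ℕ) → Kernel ℝ≥0 (Fin m → ℝ≥0)
  | 0 => Kernel.const _ (Measure.dirac (fun i => i.elim0))
  | m + 1 => consKernel (jointKernel K m) ∘ₖ K

instance isMarkovKernel_jointKernel (K : Kernel ℝ≥0 ℝ≥0) [IsMarkovKernel K] (m : ℕ) :
    IsMarkovKernel (jointKernel K m) := by
  induction m with
  | zero => rw [jointKernel]; infer_instance
  | succ m ih => rw [jointKernel]; infer_instance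

lemma jointKernel_apply (K : Kernel ℝ≥0 ℝ≥0) [IsMarkovKernel K] (m : ℕ) (y : ℝ≥0) :
    jointKernel K m y = jointLaw K m y := by
  induction m generalizing y with
  | zero => simp [jointKernel, jointLaw]
  | succ m ih =>
    rw [jointKernel, jointLaw, Kernel.comp_apply]
    congr 1
    funext x
    rw [consKernel_apply, ih]

lemma integral_bind_kernel {α β : Type*} [MeasurableSpace α] [MeasurableSpace β] (μ : Measure α)
    [IsProbabilityMeasure μ] (κ : Kernel α β) [IsMarkovKernel κ] {F : β → ℝ} (hF : Measurable F)
    {C : ℝ} (hC : ∀ x, |F x| ≤ C) : ∫ z, F z ∂(μ.bind κ) = ∫ x, ∫ z, F z ∂(κ x) ∂μ := by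
  have h := Kernel.integral_comp (κ := Kernel.const Unit μ) (η := κ) (a := ()) (f := F)
    (Integrable.of_bound hF.aestronglyMeasurable C (ae_of_all _ hC))
  simpa [Kernel.comp_apply] using h

lemma integral_consKernel {α : Type*} [MeasurableSpace α] {m : ℕ} (J : Kernel α (Fin m → α))
    [IsSFiniteKernel J] (x : α) {F : (Fin (m + 1) → α) → ℝ} (hF : Measurable F) :
    ∫ z, F z ∂(consKernel J x) = ∫ z, F (Fin.cons x z) ∂(J x) := by
  rw [consKernel_apply]
  exact integral_map (measurable_finCons.comp measurable_prodMk_left).aemeasurable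
    hF.aestronglyMeasurable

lemma integral_jointKernel_succ (K : Kernel ℝ≥0 ℝ≥0) [IsMarkovKernel K] (m : ℕ) (y : ℝ≥0)
    {F : (Fin (m + 1) → ℝ≥0) → ℝ} (hF : Measurable F) {C : ℝ} (hC : ∀ x, |F x| ≤ C) :
    ∫ z, F z ∂(jointKernel K (m + 1) y)
      = ∫ x, ∫ z, F (Fin.cons x z) ∂(jointKernel K m x) ∂(K y) := by
  rw [jointKernel, Kernel.comp_apply, integral_bind_kernel _ _ hF hC]
  exact integral_congr_ae (ae_of_all _ fun x => integral_consKernel _ _ hF)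

lemma integral_jointLaw0 (K : Kernel ℝ≥0 ℝ≥0) [IsMarkovKernel K] (m : ℕ) (H0 : Measure ℝ≥0)
    [IsProbabilityMeasure H0]
    {F : (Fin (m + 1) → ℝ≥0) → ℝ} (hF : Measurable F) {C : ℝ} (hC : ∀ x, |F x| ≤ C) :
    ∫ z, F z ∂(jointLaw0 K m H0)
      = ∫ x, ∫ z, F (Fin.cons x z) ∂(jointKernel K m x) ∂H0 := by
  have : jointLaw0 K m H0 = H0.bind (consKernel (jointKernel K m)) := by
    rw [jointLaw0]
    congr 1
    funext x
    rw [consKernel_apply, jointKernel_apply]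
  rw [this, integral_bind_kernel _ _ hF hC]
  exact integral_congr_ae (ae_of_all _ fun x => integral_consKernel _ _ hF)

/-- `tailChainLawE` as a Markov kernel in the starting point. -/
def tailKernel (G : Measure ℝ≥0) (m : ℕ) : Kernel ℝ≥0∞ (Fin m → ℝ≥0∞) :=
  (Kernel.id ×ₖ Kernel.const _ (Measure.pi fun _ : Fin m => G)).map
    (fun p i => p.1 * ∏ j ∈ Finset.Iic i, (p.2 j : ℝ≥0∞))

lemma measurable_tailPath (m : ℕ) :
    Measurable (fun (p : ℝ≥0∞ × (Fin m → ℝ≥0)) (i : Fin m) =>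
      p.1 * ∏ j ∈ Finset.Iic i, (p.2 j : ℝ≥0∞)) := by
  fun_prop

instance (G : Measure ℝ≥0) [IsProbabilityMeasure G] (m : ℕ) : IsMarkovKernel (tailKernel G m) :=
  Kernel.IsMarkovKernel.map _ (measurable_tailPath m)

lemma tailKernel_apply (G : Measure ℝ≥0) [IsProbabilityMeasure G] (m : ℕ) (x : ℝ≥0∞) :
    tailKernel G m x = tailChainLawE G m x := by
  rw [tailKernel, Kernel.map_apply _ (measurable_tailPath m), Kernel.prod_apply, Kernel.id_apply,
    Kernel.const_apply, Measure.dirac_prod,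
    Measure.map_map (measurable_tailPath m) measurable_prodMk_left]
  rfl

/-- The functional `x ↦ E_x[f(x, T*_1, …, T*_m)]` of the tail chain. -/
def tailMean (G : Measure ℝ≥0) (m : ℕ) (f : C(Fin (m + 1) → ℝ≥0∞, ℝ)) (x : ℝ≥0∞) : ℝ :=
  ∫ ξ, f (Fin.cons x fun i => x * ∏ j ∈ Finset.Iic i, (ξ j : ℝ≥0∞))
    ∂(Measure.pi fun _ : Fin m => G)

lemma abs_apply_le_norm {X : Type*} [TopologicalSpace X] [CompactSpace X] (f : C(X, ℝ)) (x : X) :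
    |f x| ≤ ‖f‖ := f.norm_coe_le_norm x

lemma abs_integral_le_of_bound {X : Type*} [MeasurableSpace X] {μ : Measure X}
    [IsProbabilityMeasure μ] {f : X → ℝ} {C : ℝ} (h : ∀ x, |f x| ≤ C) : |∫ x, f x ∂μ| ≤ C := by
  simpa using norm_integral_le_of_norm_le_const (μ := μ) (f := f)
    (ae_of_all _ h)

lemma abs_tailMean_le (G : Measure ℝ≥0) [IsProbabilityMeasure G] (m : ℕ)
    (f : C(Fin (m + 1) → ℝ≥0∞, ℝ)) (x : ℝ≥0∞) : |tailMean G m f x| ≤ ‖f‖ :=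
  abs_integral_le_of_bound fun _ => abs_apply_le_norm f _

lemma measurable_finCons_const {α : Type*} [MeasurableSpace α] {m : ℕ} (x : α) :
    Measurable (fun z : Fin m → α => (Fin.cons x z : Fin (m + 1) → α)) :=
  measurable_finCons.comp measurable_prodMk_left

lemma tailMean_eq (G : Measure ℝ≥0) [IsProbabilityMeasure G] (m : ℕ)
    (f : C(Fin (m + 1) → ℝ≥0∞, ℝ)) (x : ℝ≥0∞) :
    tailMean G m f x = ∫ z, f z ∂(consKernel (tailKernel G m) x) := by
  rw [integral_consKernel _ _ f.continuous.measurable, tailKernel_apply, tailChainLawE, tailMean,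
    integral_map]
  · exact ((measurable_tailPath m).comp measurable_prodMk_left).aemeasurable
  · exact (f.continuous.measurable.comp (measurable_finCons_const x)).aestronglyMeasurable

lemma integral_nuStar (G : Measure ℝ≥0) [IsProbabilityMeasure G] (m : ℕ) (να : Measure ℝ≥0∞)
    (f : C(Fin (m + 1) → ℝ≥0∞, ℝ)) (hf : ∀ x, 0 ≤ f x) :
    ∫ x, f x ∂(nuStar G m να) = ∫ x, tailMean G m f x ∂να := by
  have h : nuStar G m να = να.bind (consKernel (tailKernel G m)) := by
    rw [nuStar]
    congr 1
    funext x
    rw [consKernel_apply, tailKernel_apply]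
  have hm := f.continuous.measurable
  have hmean : StronglyMeasurable fun x => ∫ z, f z ∂(consKernel (tailKernel G m) x) :=
    hm.stronglyMeasurable.integral_kernel
  simp_rw [tailMean_eq]
  rw [h, integral_eq_lintegral_of_nonneg_ae (ae_of_all _ hf) hm.aestronglyMeasurable,
    Measure.lintegral_bind (Kernel.aemeasurable _) hm.ennreal_ofReal.aemeasurable,
    integral_eq_lintegral_of_nonneg_ae (ae_of_all _ fun x => integral_nonneg hf)
      hmean.aestronglyMeasurable]
  congr 1
  refine lintegral_congr fun x => ?_
  rw [ofReal_integral_eq_lintegral_ofReal _ (ae_of_all _ hf)]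
  exact Integrable.of_bound hm.aestronglyMeasurable ‖f‖ (ae_of_all _ (abs_apply_le_norm f))

lemma continuous_tailMean (G : Measure ℝ≥0) [IsProbabilityMeasure G] (m : ℕ)
    (f : C(Fin (m + 1) → ℝ≥0∞, ℝ)) : Continuous (tailMean G m f) := by
  refine continuous_of_dominated (bound := fun _ => ‖f‖) (fun x => ?_)
    (fun x => ae_of_all _ fun ξ => abs_apply_le_norm f _) (integrable_const _)
    (ae_of_all _ fun ξ => ?_)
  · exact (f.continuous.measurable.comp ((measurable_finCons_const x).comp
      ((measurable_tailPath m).comp measurable_prodMk_left))).aestronglyMeasurable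
  · refine f.continuous.comp (Continuous.finCons continuous_id (continuous_pi fun i => ?_))
    refine ENNReal.continuous_mul_const ?_
    rw [← ENNReal.ofNNReal_finsetProd]
    exact ENNReal.coe_ne_top

/-- The section `w ↦ f (x, w)` of a continuous function on paths. -/
def consSection {m : ℕ} (f : C(Fin (m + 1) → ℝ≥0∞, ℝ)) (x : ℝ≥0∞) : C(Fin m → ℝ≥0∞, ℝ) where
  toFun w := f (Fin.cons x w)
  continuous_toFun := f.continuous.comp (Continuous.finCons continuous_const continuous_id)

lemma continuous_consSection {m : ℕ} (f : C(Fin (m + 1) → ℝ≥0∞, ℝ)) :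
    Continuous (consSection f) :=
  ContinuousMap.continuous_of_continuous_uncurry _
    (f.continuous.comp (Continuous.finCons continuous_fst continuous_snd))

lemma prod_Iic_succ {M : Type*} [CommMonoid M] {m : ℕ} (g : Fin (m + 1) → M) (i : Fin m) :
    ∏ j ∈ Finset.Iic i.succ, g j = g 0 * ∏ j ∈ Finset.Iic i, g j.succ := by
  have : Finset.Iic i.succ = insert 0 ((Finset.Iic i).map (Fin.succEmb m)) := by
    ext j
    refine Fin.cases ?_ (fun k => ?_) j <;> simp
  rw [this, Finset.prod_insert (by simp), Finset.prod_map]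
  rfl

lemma tailMean_succ (G : Measure ℝ≥0) [IsProbabilityMeasure G] (m : ℕ)
    (f : C(Fin (m + 2) → ℝ≥0∞, ℝ)) (x : ℝ≥0∞) :
    tailMean G (m + 1) f x = ∫ ξ, tailMean G m (consSection f x) (x * (ξ : ℝ≥0∞)) ∂G := by
  have hmp := (measurePreserving_piFinSuccAbove (fun _ : Fin (m + 1) => G) 0).symm
  rw [tailMean, ← hmp.integral_comp', integral_prod]
  · refine integral_congr_ae (ae_of_all _ fun ξ => integral_congr_ae (ae_of_all _ fun η => ?_))
    simp only [consSection, ContinuousMap.coe_mk]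
    congr 2
    funext i
    refine Fin.cases ?_ (fun k => ?_) i
    · have : Finset.Iic (0 : Fin (m + 1)) = {0} := by ext j; simp
      simp [this, MeasurableEquiv.piFinSuccAbove, Fin.insertNthEquiv]
    · simp [prod_Iic_succ, MeasurableEquiv.piFinSuccAbove, Fin.insertNthEquiv, mul_assoc]
  · refine Integrable.of_bound (C := ‖f‖) ?_ (ae_of_all _ fun p => abs_apply_le_norm f _)
    exact (f.continuous.measurable.comp ((measurable_finCons_const x).comp
      ((measurable_tailPath (m + 1)).comp (measurable_prodMk_left.comp
        hmp.measurable)))).aestronglyMeasurable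

/-- A continuous cutoff on `[0,∞]`, equal to `0` where `c * z ≤ 1` and to `1` where `2 ≤ c * z`. -/
def bump (c : ℝ≥0) : C(ℝ≥0∞, ℝ) where
  toFun z := (min ((c : ℝ≥0∞) * z - 1) 1).toReal
  continuous_toFun := by
    refine ENNReal.continuousOn_toReal.comp_continuous ?_ fun z => ?_
    · exact ((ENNReal.continuous_sub_right 1).comp
        (ENNReal.continuous_const_mul ENNReal.coe_ne_top)).min continuous_const
    · exact ne_top_of_le_ne_top ENNReal.one_ne_top (min_le_right _ _)

lemma bump_nonneg (c : ℝ≥0) (z : ℝ≥0∞) : 0 ≤ bump c z := ENNReal.toReal_nonneg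

lemma bump_le_one (c : ℝ≥0) (z : ℝ≥0∞) : bump c z ≤ 1 := by
  change (min ((c : ℝ≥0∞) * z - 1) 1).toReal ≤ 1
  simpa using ENNReal.toReal_mono ENNReal.one_ne_top (min_le_right ((c : ℝ≥0∞) * z - 1) 1)

lemma abs_bump_le_one (c : ℝ≥0) (z : ℝ≥0∞) : |bump c z| ≤ 1 := by
  rw [abs_of_nonneg (bump_nonneg c z)]
  exact bump_le_one c z

lemma bump_eq_zero {c : ℝ≥0} {z : ℝ≥0∞} (h : c * z ≤ 1) : bump c z = 0 := by
  change (min ((c : ℝ≥0∞) * z - 1) 1).toReal = 0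
  rw [tsub_eq_zero_of_le h]
  simp

lemma bump_eq_one {c : ℝ≥0} {z : ℝ≥0∞} (h : 2 ≤ c * z) : bump c z = 1 := by
  change (min ((c : ℝ≥0∞) * z - 1) 1).toReal = 1
  rw [min_eq_right]
  · simp
  · refine ENNReal.le_sub_of_add_le_left ENNReal.one_ne_top ?_
    simpa [one_add_one_eq_two] using h

lemma tendsto_bump_inv_natCast (z : ℝ≥0) :
    Tendsto (fun n : ℕ => bump (n + 1 : ℝ≥0)⁻¹ z) atTop (𝓝 0) := by
  obtain ⟨N, hN⟩ := exists_nat_ge z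
  refine tendsto_const_nhds.congr' ?_
  filter_upwards [eventually_ge_atTop N] with n hn
  refine (bump_eq_zero ?_).symm
  have h : z ≤ n + 1 := hN.trans (le_trans (by exact_mod_cast hn) le_self_add)
  rw [← ENNReal.coe_mul]
  have : (n + 1 : ℝ≥0)⁻¹ * z ≤ 1 := by
    rw [inv_mul_le_iff₀ (by positivity)]; simpa using h
  exact_mod_cast this

lemma tendsto_bump_natCast (z : ℝ≥0) :
    Tendsto (fun n : ℕ => 1 - bump (n + 1 : ℝ≥0) z) atTop
      (𝓝 (({0} : Set ℝ≥0).indicator 1 z)) := by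
  rcases eq_or_ne z 0 with rfl | hz
  · simp [bump_eq_zero]
  obtain ⟨N, hN⟩ := exists_nat_ge (2 / z)
  refine tendsto_const_nhds.congr' ?_
  filter_upwards [eventually_ge_atTop N] with n hn
  have h : 2 / z ≤ n + 1 := hN.trans (le_trans (by exact_mod_cast hn) le_self_add)
  rw [bump_eq_one]
  · simp [hz]
  · rw [div_le_iff₀ (pos_iff_ne_zero.2 hz)] at h
    exact_mod_cast h

lemma integrable_comp_coe (ρ : Measure ℝ≥0) [IsFiniteMeasure ρ] (f : C(ℝ≥0∞, ℝ)) :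
    Integrable (fun z : ℝ≥0 => f z) ρ :=
  Integrable.of_bound
    (f.continuous.measurable.comp measurable_coe_nnreal_ennreal).aestronglyMeasurable ‖f‖
    (ae_of_all _ fun _ => abs_apply_le_norm f _)

lemma tendsto_integral_bump_inv (ρ : Measure ℝ≥0) [IsFiniteMeasure ρ] :
    Tendsto (fun n : ℕ => ∫ z, bump (n + 1 : ℝ≥0)⁻¹ (z : ℝ≥0∞) ∂ρ) atTop (𝓝 0) := by
  simpa using tendsto_integral_of_dominated_convergence (μ := ρ)
    (F := fun (n : ℕ) (z : ℝ≥0) => bump (n + 1 : ℝ≥0)⁻¹ z) (f := fun _ => 0) (fun _ => (1 : ℝ))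
    (fun n => (integrable_comp_coe ρ _).aestronglyMeasurable) (integrable_const _)
    (fun n => ae_of_all _ fun z => abs_bump_le_one _ _)
    (ae_of_all _ tendsto_bump_inv_natCast)

lemma tendsto_integral_one_sub_bump (ρ : Measure ℝ≥0) [IsFiniteMeasure ρ] :
    Tendsto (fun n : ℕ => ∫ z, (1 - bump (n + 1 : ℝ≥0) (z : ℝ≥0∞)) ∂ρ) atTop
      (𝓝 (ρ.real {0})) := by
  have h := tendsto_integral_of_dominated_convergence (μ := ρ)
    (F := fun (n : ℕ) (z : ℝ≥0) => 1 - bump (n + 1 : ℝ≥0) z)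
    (f := ({0} : Set ℝ≥0).indicator 1) (fun _ => (1 : ℝ))
    (fun n => ((integrable_const _).sub (integrable_comp_coe ρ _)).aestronglyMeasurable)
    (integrable_const _)
    (fun n => ae_of_all _ fun z => by
      rw [Real.norm_eq_abs, abs_le]
      constructor <;> linarith [bump_nonneg (n + 1 : ℝ≥0) z, bump_le_one (n + 1 : ℝ≥0) z])
    (ae_of_all _ tendsto_bump_natCast)
  rwa [integral_indicator_one (measurableSet_singleton _)] at h

lemma exists_real_Iio_diff_le {ι : Type*} {l : Filter ι} {ρ : ι → Measure ℝ≥0}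
    [∀ i, IsProbabilityMeasure (ρ i)] {ρ' : Measure ℝ≥0} [IsProbabilityMeasure ρ']
    (hW : ∀ f : C(ℝ≥0∞, ℝ), Tendsto (fun i => ∫ z, f (z : ℝ≥0∞) ∂(ρ i)) l
      (𝓝 (∫ z, f (z : ℝ≥0∞) ∂ρ')))
    {S : Set ℝ≥0} (hS : S ⊆ {0}) (hlim : Tendsto (fun i => (ρ i).real S) l (𝓝 (ρ'.real {0})))
    {η : ℝ} (hη : 0 < η) :
    ∃ δ > 0, ∀ᶠ i in l, (ρ i).real (Set.Iio δ \ S) ≤ η := by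
  obtain ⟨n, hn⟩ := ((tendsto_integral_one_sub_bump ρ').eventually_lt_const
    (show ρ'.real {0} < ρ'.real {0} + η by linarith)).exists
  refine ⟨(n + 1 : ℝ≥0)⁻¹, by positivity, ?_⟩
  have h1 : Tendsto (fun i => ∫ z, (1 - bump (n + 1 : ℝ≥0) (z : ℝ≥0∞)) ∂(ρ i) - (ρ i).real S) l
      (𝓝 (∫ z, (1 - bump (n + 1 : ℝ≥0) (z : ℝ≥0∞)) ∂ρ' - ρ'.real {0})) :=
    (hW (1 - bump (n + 1 : ℝ≥0))).sub hlim
  filter_upwards [h1.eventually_lt_const (show _ < η by linarith)] with i hi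
  have hSm : MeasurableSet S := (Set.finite_singleton 0).subset hS |>.measurableSet
  have hSI : S ⊆ Set.Iio (n + 1 : ℝ≥0)⁻¹ := hS.trans (by simp)
  have h2 : (ρ i).real (Set.Iio (n + 1 : ℝ≥0)⁻¹ \ S)
      = (ρ i).real (Set.Iio (n + 1 : ℝ≥0)⁻¹) - (ρ i).real S :=
    measureReal_sdiff hSI hSm
  have h3 : (ρ i).real (Set.Iio (n + 1 : ℝ≥0)⁻¹)
      ≤ ∫ z, (1 - bump (n + 1 : ℝ≥0) (z : ℝ≥0∞)) ∂(ρ i) := by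
    rw [← integral_indicator_one measurableSet_Iio]
    refine integral_mono ((integrable_const _).indicator measurableSet_Iio)
      ((integrable_const _).sub (integrable_comp_coe _ _)) fun z => ?_
    by_cases hz : z ∈ Set.Iio (n + 1 : ℝ≥0)⁻¹
    · rw [Set.indicator_of_mem hz, bump_eq_zero]
      · simp
      · have : (n + 1 : ℝ≥0) * z ≤ 1 := by
          calc (n + 1 : ℝ≥0) * z ≤ (n + 1) * (n + 1 : ℝ≥0)⁻¹ := by gcongr; exact (Set.mem_Iio.1 hz).le
            _ = 1 := mul_inv_cancel₀ (by positivity)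
        exact_mod_cast this
    · rw [Set.indicator_of_notMem hz]
      linarith [bump_le_one (n + 1 : ℝ≥0) z]
  linarith

/-- An extended continuous mapping theorem: under weak convergence `ρ i → ρ'`, the integrals of
`g i` converge to that of `g'` as soon as `g i` converges continuously to `g'` at every positive
point and along a filter `L` at `0` that asymptotically carries all the mass near `0`. -/
lemma tendsto_integral_of_continuous_convergence {ι : Type*} {l : Filter ι}
    {ρ : ι → Measure ℝ≥0} [∀ i, IsProbabilityMeasure (ρ i)] {ρ' : Measure ℝ≥0}
    [IsProbabilityMeasure ρ']
    (hW : ∀ f : C(ℝ≥0∞, ℝ), Tendsto (fun i => ∫ z, f (z : ℝ≥0∞) ∂(ρ i)) l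
      (𝓝 (∫ z, f (z : ℝ≥0∞) ∂ρ')))
    {L : Filter ℝ≥0} (hL0 : L ≤ 𝓝 0)
    (hL : ∀ V ∈ L, ∀ η : ℝ, 0 < η → ∃ δ > 0, ∀ᶠ i in l, (ρ i).real (Set.Iio δ \ V) ≤ η)
    {g : ι → ℝ≥0 → ℝ} {g' : C(ℝ≥0∞, ℝ)} {C : ℝ} (hgm : ∀ i, Measurable (g i))
    (hgC : ∀ i z, |g i z| ≤ C)
    (hg : ∀ z : ℝ≥0, 0 < z →
      Tendsto (fun p : ι × ℝ≥0 => g p.1 p.2) (l ×ˢ 𝓝 z) (𝓝 (g' z)))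
    (hg0 : Tendsto (fun p : ι × ℝ≥0 => g p.1 p.2) (l ×ˢ L) (𝓝 (g' 0))) :
    Tendsto (fun i => ∫ z, g i z ∂(ρ i)) l (𝓝 (∫ z, g' (z : ℝ≥0∞) ∂ρ')) := by
  have hgi (i) : Integrable (g i) (ρ i) :=
    Integrable.of_bound (hgm i).aestronglyMeasurable C (ae_of_all _ (hgC i))
  have hg'm : Measurable fun z : ℝ≥0 => g' z :=
    g'.continuous.measurable.comp measurable_coe_nnreal_ennreal
  have hg'c : Continuous fun z : ℝ≥0 => g' z := g'.continuous.comp ENNReal.continuous_coe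
  suffices h : Tendsto (fun i => ∫ z, (g i z - g' z) ∂(ρ i)) l (𝓝 0) by
    have := h.add (hW g')
    simp only [zero_add] at this
    refine this.congr fun i => ?_
    rw [integral_sub (hgi i) (integrable_comp_coe _ _)]
    ring
  rw [Metric.tendsto_nhds]
  intro ε hε
  set D : ℝ := |C| + ‖g'‖ + 1 with hD
  have hDpos : 0 < D := by positivity
  have hbound (i z) : |g i z - g' (z : ℝ≥0)| ≤ D := by
    have h1 := hgC i z
    have h2 := abs_apply_le_norm g' (z : ℝ≥0∞)
    have h3 := abs_sub (g i z) (g' z)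
    linarith [le_abs_self C]
  have hη : 0 < ε / (4 * D) := by positivity
  obtain ⟨n, hn⟩ := ((tendsto_integral_bump_inv ρ').eventually_lt_const hη).exists
  set P : Set (ι × ℝ≥0) := {p | |g p.1 p.2 - g' (p.2 : ℝ≥0)| < ε / 4} with hP
  have hmem {Λ : Filter ℝ≥0} {z : ℝ≥0} (hΛ : Λ ≤ 𝓝 z)
      (h : Tendsto (fun p : ι × ℝ≥0 => g p.1 p.2) (l ×ˢ Λ) (𝓝 (g' z))) : P ∈ l ×ˢ Λ := by
    have h' : Tendsto (fun p : ι × ℝ≥0 => g' (p.2 : ℝ≥0)) (l ×ˢ Λ) (𝓝 (g' z)) :=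
      (hg'c.tendsto z).comp (tendsto_snd.mono_right hΛ)
    have h'' := (h.sub h').abs
    simp only [sub_self, abs_zero] at h''
    exact h''.eventually_lt_const (by positivity)
  obtain ⟨U, hU, V, hV, hUV⟩ := mem_prod_iff.1 (hmem hL0 (by simpa using hg0))
  obtain ⟨δ, hδ, hδV⟩ := hL V hV _ hη
  have hKc : P ∈ l ×ˢ 𝓝ˢ (Set.Icc δ (2 * (n + 1))) :=
    isCompact_Icc.mem_prod_nhdsSet_of_forall fun z hz => hmem le_rfl (hg z (hδ.trans_le hz.1))
  obtain ⟨U', hU', W, hW', hUW⟩ := mem_prod_iff.1 hKc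
  filter_upwards [hU, hU', hδV, (hW (bump (n + 1 : ℝ≥0)⁻¹)).eventually_lt_const hn]
    with i hiU hiU' hiV hin
  set B : Set ℝ≥0 := Set.Iio δ ∩ {z | ε / 4 ≤ |g i z - g' (z : ℝ≥0)|} with hB
  have hBm : MeasurableSet B :=
    measurableSet_Iio.inter (measurableSet_le measurable_const ((hgm i).sub hg'm).abs)
  have hBV : B ⊆ Set.Iio δ \ V := fun z hz => ⟨hz.1, fun hzV =>
    (Set.mem_ofPred.1 hz.2).not_gt (show _ < _ from hUV (Set.mk_mem_prod hiU hzV))⟩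
  have hpt (z : ℝ≥0) : |g i z - g' z|
      ≤ ε / 4 + D * bump (n + 1 : ℝ≥0)⁻¹ z + B.indicator (fun _ => D) z := by
    have hb := mul_nonneg hDpos.le (bump_nonneg (n + 1 : ℝ≥0)⁻¹ z)
    have hi : 0 ≤ B.indicator (fun _ => D) z := Set.indicator_nonneg (fun _ _ => hDpos.le) _
    by_cases hs : |g i z - g' z| < ε / 4
    · linarith
    rcases lt_or_ge z δ with hz | hz
    · rw [Set.indicator_of_mem (show z ∈ B from ⟨hz, not_lt.1 hs⟩)]
      linarith [hbound i z]
    · rcases le_or_gt z (2 * (n + 1)) with hz' | hz'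
      · exact absurd (hUW (Set.mk_mem_prod hiU' (subset_of_mem_nhdsSet hW' ⟨hz, hz'⟩))) hs
      · rw [bump_eq_one]
        · linarith [hbound i z]
        · have : 2 ≤ (n + 1 : ℝ≥0)⁻¹ * z := by
            rw [le_inv_mul_iff₀ (by positivity), mul_comm]
            exact hz'.le
          exact_mod_cast this
  have hint : |∫ z, (g i z - g' z) ∂(ρ i)|
      ≤ ε / 4 + D * ∫ z, bump (n + 1 : ℝ≥0)⁻¹ (z : ℝ≥0∞) ∂(ρ i) + D * (ρ i).real B := by
    have hb := (integrable_comp_coe (ρ i) (bump (n + 1 : ℝ≥0)⁻¹)).const_mul D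
    have hI : Integrable (B.indicator fun _ => D) (ρ i) := (integrable_const _).indicator hBm
    have hc : Integrable (fun _ : ℝ≥0 => ε / 4) (ρ i) := integrable_const _
    refine (norm_integral_le_of_norm_le (f := fun z : ℝ≥0 => g i z - g' z) ((hc.add hb).add hI) (ae_of_all _ hpt)).trans_eq ?_
    rw [integral_add' (hc.add hb) hI, integral_add' hc hb, integral_const_mul,
      integral_indicator_const _ hBm]
    simp [mul_comm]
  have h1 : D * ∫ z, bump (n + 1 : ℝ≥0)⁻¹ (z : ℝ≥0∞) ∂(ρ i) ≤ D * (ε / (4 * D)) := by gcongr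
  have h2 : D * (ρ i).real B ≤ D * (ε / (4 * D)) := by
    gcongr
    exact (measureReal_mono hBV).trans hiV
  have h3 : D * (ε / (4 * D)) = ε / 4 := by field_simp
  rw [Real.dist_eq, sub_zero]
  linarith

lemma measurable_coe_div {m : ℕ} (t : ℝ≥0) :
    Measurable fun (y : Fin m → ℝ≥0) (i : Fin m) => ((y i / t : ℝ≥0) : ℝ≥0∞) := by
  fun_prop

/-- The functional `x ↦ E[f(x, X_1/t, …, X_m/t) | X_0 = t x]` of the rescaled chain. -/
def scaledMean (K : Kernel ℝ≥0 ℝ≥0) (m : ℕ) (f : C(Fin (m + 1) → ℝ≥0∞, ℝ)) (t x : ℝ≥0) : ℝ :=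
  ∫ y, f (Fin.cons (x : ℝ≥0∞) fun i => ((y i / t : ℝ≥0) : ℝ≥0∞)) ∂(jointKernel K m (t * x))

section

variable (K : Kernel ℝ≥0 ℝ≥0) [IsMarkovKernel K]

lemma abs_scaledMean_le (m : ℕ) (f : C(Fin (m + 1) → ℝ≥0∞, ℝ)) (t x : ℝ≥0) :
    |scaledMean K m f t x| ≤ ‖f‖ :=
  abs_integral_le_of_bound fun _ => abs_apply_le_norm f _

lemma measurable_scaledMean (m : ℕ) (f : C(Fin (m + 1) → ℝ≥0∞, ℝ)) (t : ℝ≥0) :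
    Measurable (scaledMean K m f t) := by
  have hF : Measurable fun p : ℝ≥0 × (Fin m → ℝ≥0) =>
      f (Fin.cons (p.1 : ℝ≥0∞) fun i => ((p.2 i / t : ℝ≥0) : ℝ≥0∞)) :=
    f.continuous.measurable.comp (measurable_finCons.comp
      ((measurable_coe_nnreal_ennreal.comp measurable_fst).prodMk
        ((measurable_coe_div t).comp measurable_snd)))
  exact (hF.stronglyMeasurable.integral_kernel_prod_right'
    (κ := (jointKernel K m).comap (t * ·) (measurable_const_mul t))).measurable

lemma integrable_scaledMean_integrand (m : ℕ) (f : C(Fin (m + 1) → ℝ≥0∞, ℝ)) (t x s : ℝ≥0) :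
    Integrable (fun y : Fin m → ℝ≥0 =>
      f (Fin.cons (x : ℝ≥0∞) fun i => ((y i / t : ℝ≥0) : ℝ≥0∞))) (jointKernel K m s) :=
  Integrable.of_bound (f.continuous.measurable.comp
    ((measurable_finCons_const _).comp (measurable_coe_div t))).aestronglyMeasurable ‖f‖
    (ae_of_all _ fun _ => abs_apply_le_norm f _)

lemma abs_scaledMean_sub_le (m : ℕ) (f f' : C(Fin (m + 1) → ℝ≥0∞, ℝ)) (t x : ℝ≥0) :
    |scaledMean K m f t x - scaledMean K m f' t x| ≤ ‖f - f'‖ := by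
  rw [scaledMean, scaledMean, ← integral_sub (integrable_scaledMean_integrand K m f t x _)
    (integrable_scaledMean_integrand K m f' t x _)]
  exact abs_integral_le_of_bound fun _ => abs_apply_le_norm (f - f') _

lemma scaledMean_succ (m : ℕ) (f : C(Fin (m + 2) → ℝ≥0∞, ℝ)) {t : ℝ≥0} (ht : t ≠ 0) (x : ℝ≥0) :
    scaledMean K (m + 1) f t x
      = ∫ z, scaledMean K m (consSection f x) t z ∂((K (t * x)).map (· / t)) := by
  rw [integral_map (by fun_prop) (measurable_scaledMean K m _ t).aestronglyMeasurable, scaledMean,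
    integral_jointKernel_succ K m _
      (F := fun y => f (Fin.cons (x : ℝ≥0∞) fun i => ((y i / t : ℝ≥0) : ℝ≥0∞)))
      (f.continuous.measurable.comp ((measurable_finCons_const _).comp (measurable_coe_div t)))
      (fun _ => abs_apply_le_norm f _)]
  refine integral_congr_ae (ae_of_all _ fun z => ?_)
  simp only [scaledMean, mul_div_cancel₀ z ht]
  refine integral_congr_ae (ae_of_all _ fun y => ?_)
  simp only [consSection, ContinuousMap.coe_mk]
  congr 2
  funext i
  refine Fin.cases ?_ (fun k => ?_) i <;> simp

lemma tendsto_scaledMean_zero_right (m : ℕ) (f : C(Fin (m + 1) → ℝ≥0∞, ℝ)) :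
    Tendsto (fun t : ℝ≥0 => scaledMean K m f t 0) atTop (𝓝 (f 0)) := by
  simp only [scaledMean, mul_zero]
  have h : f 0 = ∫ _, f 0 ∂(jointKernel K m 0) := by simp
  rw [h]
  refine tendsto_integral_filter_of_dominated_convergence (fun _ => ‖f‖)
    (Eventually.of_forall fun t => (integrable_scaledMean_integrand K m f t 0 0).1)
    (Eventually.of_forall fun t => ae_of_all _ fun _ => abs_apply_le_norm f _)
    (integrable_const _) (ae_of_all _ fun y => ?_)
  suffices h : Tendsto (fun t : ℝ≥0 => (Fin.cons ((0 : ℝ≥0) : ℝ≥0∞)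
      fun i => ((y i / t : ℝ≥0) : ℝ≥0∞) : Fin (m + 1) → ℝ≥0∞)) atTop (𝓝 0) from
    (f.continuous.tendsto 0).comp h
  refine tendsto_pi_nhds.2 fun i => ?_
  refine Fin.cases (by simp) (fun k => ?_) i
  simp only [Fin.cons_succ]
  have : Tendsto (fun t : ℝ≥0 => y k / t) atTop (𝓝 0) := by
    rw [← NNReal.tendsto_coe]
    simp only [NNReal.coe_div]
    exact tendsto_const_nhds.div_atTop (NNReal.tendsto_coe_atTop.2 tendsto_id)
  exact_mod_cast (ENNReal.continuous_coe.tendsto 0).comp this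

lemma tailMean_zero_right (G : Measure ℝ≥0) [IsProbabilityMeasure G] (m : ℕ)
    (f : C(Fin (m + 1) → ℝ≥0∞, ℝ)) : tailMean G m f 0 = f 0 := by
  have : (Fin.cons 0 0 : Fin (m + 1) → ℝ≥0∞) = 0 := by
    funext i
    refine Fin.cases ?_ (fun k => ?_) i <;> simp
  have h0 : (fun _ : Fin m => (0 : ℝ≥0∞)) = 0 := rfl
  simp [tailMean, h0, this]

end

/-- Composition of a function on `[0,∞]` with multiplication by `max u c`; the cutoff at `c > 0`
makes it continuous in `u`. -/
def compMulMax (φ : C(ℝ≥0∞, ℝ)) (c u : ℝ≥0) : C(ℝ≥0∞, ℝ) where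
  toFun z := φ (((max u c : ℝ≥0) : ℝ≥0∞) * z)
  continuous_toFun := φ.continuous.comp (ENNReal.continuous_const_mul ENNReal.coe_ne_top)

lemma continuous_compMulMax (φ : C(ℝ≥0∞, ℝ)) {c : ℝ≥0} (hc : 0 < c) :
    Continuous (compMulMax φ c) := by
  refine ContinuousMap.continuous_of_continuous_uncurry _ (φ.continuous.comp ?_)
  refine continuous_iff_continuousAt.2 fun p => ?_
  refine ENNReal.Tendsto.mul ?_ (Or.inl ?_) (continuous_snd.tendsto p) (Or.inr ENNReal.coe_ne_top)
  · exact (ENNReal.continuous_coe.comp (continuous_fst.max continuous_const)).tendsto p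
  · exact ENNReal.coe_ne_zero.2 (hc.trans_le (le_max_right _ _)).ne'

lemma tendsto_mul_prod_nhds {x : ℝ≥0} (hx : 0 < x) :
    Tendsto (fun p : ℝ≥0 × ℝ≥0 => p.1 * p.2) (atTop ×ˢ 𝓝 x) atTop :=
  tendsto_fst.atTop_mul_pos hx tendsto_snd

lemma KernelDOA.tendsto_prod_nhds {K : Kernel ℝ≥0 ℝ≥0} [IsMarkovKernel K] {G : Measure ℝ≥0}
    (hK : KernelDOA K G) {x : ℝ≥0} (hx : 0 < x) (φ : C(ℝ≥0∞, ℝ)) :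
    Tendsto (fun p : ℝ≥0 × ℝ≥0 => ∫ y, φ ((y / p.1 : ℝ≥0) : ℝ≥0∞) ∂(K (p.1 * p.2)))
      (atTop ×ˢ 𝓝 x) (𝓝 (∫ ξ, φ ((x : ℝ≥0∞) * (ξ : ℝ≥0∞)) ∂G)) := by
  have hc : 0 < x / 2 := by positivity
  have h1 : Tendsto (fun p : ℝ≥0 × ℝ≥0 => ‖compMulMax φ (x / 2) p.2 - compMulMax φ (x / 2) x‖)
      (atTop ×ˢ 𝓝 x) (𝓝 0) := by
    rw [← tendsto_iff_norm_sub_tendsto_zero]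
    exact ((continuous_compMulMax φ hc).tendsto x).comp tendsto_snd
  have h2 := (hK (compMulMax φ (x / 2) x)).comp (tendsto_mul_prod_nhds hx)
  have hlim : ∫ ξ, compMulMax φ (x / 2) x (ξ : ℝ≥0∞) ∂G = ∫ ξ, φ ((x : ℝ≥0∞) * ξ) ∂G := by
    simp [compMulMax]
  rw [hlim] at h2
  refine tendsto_of_tendsto_of_dist h2 (squeeze_zero' (Eventually.of_forall fun _ => dist_nonneg)
    ?_ h1)
  have hgt : ∀ᶠ p : ℝ≥0 × ℝ≥0 in atTop ×ˢ 𝓝 x, x / 2 < p.2 :=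
    tendsto_snd.eventually_const_lt (NNReal.half_lt_self hx.ne')
  filter_upwards [hgt] with p hp
  have hm : Measurable fun y : ℝ≥0 => ((y / (p.1 * p.2) : ℝ≥0) : ℝ≥0∞) := by fun_prop
  have hi (ψ : C(ℝ≥0∞, ℝ)) :
      Integrable (fun y : ℝ≥0 => ψ ((y / (p.1 * p.2) : ℝ≥0) : ℝ≥0∞)) (K (p.1 * p.2)) :=
    Integrable.of_bound (ψ.continuous.measurable.comp hm).aestronglyMeasurable ‖ψ‖
      (ae_of_all _ fun _ => abs_apply_le_norm ψ _)
  have heq (y : ℝ≥0) : φ ((y / p.1 : ℝ≥0) : ℝ≥0∞)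
      = compMulMax φ (x / 2) p.2 ((y / (p.1 * p.2) : ℝ≥0) : ℝ≥0∞) := by
    have hp0 : p.2 ≠ 0 := (hc.trans hp).ne'
    simp only [compMulMax, ContinuousMap.coe_mk, max_eq_left hp.le, ← ENNReal.coe_mul]
    congr 2
    rw [mul_comm p.1, ← mul_div_assoc, mul_div_mul_left _ _ hp0]
  simp_rw [Function.comp_apply, heq]
  rw [dist_comm, Real.dist_eq, ← integral_sub (hi _) (hi _)]
  exact abs_integral_le_of_bound fun _ =>
    abs_apply_le_norm (compMulMax φ (x / 2) p.2 - compMulMax φ (x / 2) x) _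

lemma RegCond.tendsto_prod_nhds {K : Kernel ℝ≥0 ℝ≥0} (hK : RegCond K) (φ : C(ℝ≥0∞, ℝ)) :
    Tendsto (fun p : ℝ≥0 × ℝ≥0 => ∫ y, φ ((y / p.1 : ℝ≥0) : ℝ≥0∞) ∂(K (p.1 * p.2)))
      (atTop ×ˢ 𝓝 0) (𝓝 (φ 0)) := by
  by_contra hcon
  obtain ⟨s, hs, hfreq⟩ := not_tendsto_iff_exists_frequently_notMem.1 hcon
  obtain ⟨p, hp, hps⟩ := exists_seq_forall_of_frequently hfreq
  have hp1 : Tendsto (fun n => (p n).1) atTop atTop := tendsto_fst.comp hp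
  have hp2 : Tendsto (fun n => (p n).2) atTop (𝓝 0) := tendsto_snd.comp hp
  obtain ⟨k, hk, hmono⟩ := strictMono_subseq_of_tendsto_atTop hp1
  set T : ℕ → ℝ≥0 := fun n => (p (k n)).1 with hT
  have hTmono : StrictMono T := hmono
  set u : ℝ≥0 → ℝ≥0 := Function.extend T (fun n => (p (k n)).2) 0 with hu
  have hu0 : Tendsto u atTop (𝓝 0) := by
    refine NNReal.tendsto_coe.1 (Metric.tendsto_atTop.2 fun ε hε => ?_)
    have hp2k := NNReal.tendsto_coe.2 (hp2.comp hk.tendsto_atTop)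
    obtain ⟨N, hN⟩ := Metric.tendsto_atTop.1 hp2k ε hε
    refine ⟨T N, fun t ht => ?_⟩
    by_cases h : ∃ n, T n = t
    · obtain ⟨n, rfl⟩ := h
      rw [hu, hTmono.injective.extend_apply]
      exact hN n (hTmono.le_iff_le.1 ht)
    · rw [hu, Function.extend_apply' _ _ _ h]
      simpa using hε
  have hlim := (hK u hu0 φ).comp (hp1.comp hk.tendsto_atTop)
  obtain ⟨n, hn⟩ := (hlim.eventually_mem hs).exists
  refine hps (k n) ?_
  have : u (T n) = (p (k n)).2 := hTmono.injective.extend_apply _ _ _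
  have hn' : ∫ y, φ ((y / T n : ℝ≥0) : ℝ≥0∞) ∂(K (T n * u (T n))) ∈ s := hn
  rwa [this] at hn'

/-- Continuous convergence of the functionals of the rescaled chain to those of the tail chain, at
positive starting points and along the filter `L` at `0`. -/
def ScaledMeanTendsto (K : Kernel ℝ≥0 ℝ≥0) (G : Measure ℝ≥0) (L : Filter ℝ≥0) (m : ℕ) : Prop :=
  ∀ f : C(Fin (m + 1) → ℝ≥0∞, ℝ),
    (∀ z : ℝ≥0, 0 < z → Tendsto (fun p : ℝ≥0 × ℝ≥0 => scaledMean K m f p.1 p.2)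
      (atTop ×ˢ 𝓝 z) (𝓝 (tailMean G m f z))) ∧
    Tendsto (fun p : ℝ≥0 × ℝ≥0 => scaledMean K m f p.1 p.2)
      (atTop ×ˢ L) (𝓝 (tailMean G m f 0))

lemma ScaledMeanTendsto.succ {K : Kernel ℝ≥0 ℝ≥0} [IsMarkovKernel K] {G : Measure ℝ≥0}
    [IsProbabilityMeasure G] {L : Filter ℝ≥0} {m : ℕ} (ih : ScaledMeanTendsto K G L m)
    (hL0 : L ≤ 𝓝 0) {x : ℝ≥0} {Λ : Filter ℝ≥0} (hΛ : Λ ≤ 𝓝 x)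
    (hW : ∀ φ : C(ℝ≥0∞, ℝ),
      Tendsto (fun p : ℝ≥0 × ℝ≥0 => ∫ y, φ ((y / p.1 : ℝ≥0) : ℝ≥0∞) ∂(K (p.1 * p.2)))
        (atTop ×ˢ Λ) (𝓝 (∫ ξ, φ ((x : ℝ≥0∞) * (ξ : ℝ≥0∞)) ∂G)))
    (hL : ∀ V ∈ L, ∀ η : ℝ, 0 < η → ∃ δ > 0, ∀ᶠ p : ℝ≥0 × ℝ≥0 in atTop ×ˢ Λ,
      ((K (p.1 * p.2)).map (· / p.1)).real (Set.Iio δ \ V) ≤ η)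
    (f : C(Fin (m + 2) → ℝ≥0∞, ℝ)) :
    Tendsto (fun p : ℝ≥0 × ℝ≥0 => scaledMean K (m + 1) f p.1 p.2)
      (atTop ×ˢ Λ) (𝓝 (tailMean G (m + 1) f x)) := by
  have hρ (p : ℝ≥0 × ℝ≥0) : IsProbabilityMeasure ((K (p.1 * p.2)).map (· / p.1)) :=
    Measure.isProbabilityMeasure_map (by fun_prop)
  have hρ' : IsProbabilityMeasure (G.map (x * ·)) :=
    Measure.isProbabilityMeasure_map (by fun_prop)
  have hcoe (φ : C(ℝ≥0∞, ℝ)) (μ : Measure ℝ≥0) :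
      AEStronglyMeasurable (fun z : ℝ≥0 => φ z) μ :=
    (φ.continuous.measurable.comp measurable_coe_nnreal_ennreal).aestronglyMeasurable
  have hmap (φ : C(ℝ≥0∞, ℝ)) :
      ∫ z, φ (z : ℝ≥0∞) ∂(G.map (x * ·)) = ∫ ξ, φ ((x : ℝ≥0∞) * (ξ : ℝ≥0∞)) ∂G := by
    rw [integral_map (by fun_prop) (hcoe φ _)]
    simp
  have hg (q : ℝ≥0 × ℝ≥0 → ℝ) {Λ' : Filter ℝ≥0} {c : ℝ} (h : Tendsto q (atTop ×ˢ Λ') (𝓝 c)) :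
      Tendsto (fun p : (ℝ≥0 × ℝ≥0) × ℝ≥0 => q (p.1.1, p.2)) ((atTop ×ˢ Λ) ×ˢ Λ') (𝓝 c) :=
    h.comp ((tendsto_fst.comp tendsto_fst).prodMk tendsto_snd)
  have h1 := tendsto_integral_of_continuous_convergence (l := atTop ×ˢ Λ)
    (ρ := fun p : ℝ≥0 × ℝ≥0 => (K (p.1 * p.2)).map (· / p.1)) (ρ' := G.map (x * ·))
    (fun φ => by
      rw [hmap]
      refine (hW φ).congr fun p => ?_
      rw [integral_map (by fun_prop) (hcoe φ _)])
    hL0 hL (g := fun p => scaledMean K m (consSection f x) p.1)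
    (g' := ⟨tailMean G m (consSection f x), continuous_tailMean G m _⟩)
    (fun p => measurable_scaledMean K m _ p.1) (fun p => abs_scaledMean_le K m _ p.1)
    (fun z hz => hg (fun p => scaledMean K m (consSection f x) p.1 p.2) ((ih _).1 z hz))
    (hg (fun p => scaledMean K m (consSection f x) p.1 p.2) (ih _).2)
  rw [hmap] at h1
  simp only [ContinuousMap.coe_mk, ← tailMean_succ] at h1
  have h2 : Tendsto (fun p : ℝ≥0 × ℝ≥0 => ‖consSection f p.2 - consSection f x‖)
      (atTop ×ˢ Λ) (𝓝 0) := by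
    rw [← tendsto_iff_norm_sub_tendsto_zero]
    exact (((continuous_consSection f).comp ENNReal.continuous_coe).tendsto x).comp
      (tendsto_snd.mono_right hΛ)
  refine tendsto_of_tendsto_of_dist h1 (squeeze_zero' (Eventually.of_forall fun _ => dist_nonneg)
    ?_ h2)
  have hpos : ∀ᶠ p : ℝ≥0 × ℝ≥0 in atTop ×ˢ Λ, p.1 ≠ 0 := tendsto_fst.eventually_ne_atTop 0
  filter_upwards [hpos] with p hp
  have hi (F : C(Fin (m + 1) → ℝ≥0∞, ℝ)) :
      Integrable (scaledMean K m F p.1) ((K (p.1 * p.2)).map (· / p.1)) :=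
    Integrable.of_bound (measurable_scaledMean K m F p.1).aestronglyMeasurable ‖F‖
      (ae_of_all _ fun _ => abs_scaledMean_le K m F _ _)
  rw [dist_comm, scaledMean_succ K m f hp, Real.dist_eq, ← integral_sub (hi _) (hi _)]
  exact abs_integral_le_of_bound fun _ => abs_scaledMean_sub_le K m _ _ _ _

lemma scaledMeanTendsto_zero (K : Kernel ℝ≥0 ℝ≥0) (G : Measure ℝ≥0)
    [IsMarkovKernel K] [IsProbabilityMeasure G] {L : Filter ℝ≥0} (hL0 : L ≤ 𝓝 0) :
    ScaledMeanTendsto K G L 0 := by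
  intro f
  have hs (t x : ℝ≥0) : scaledMean K 0 f t x = f (Fin.cons (x : ℝ≥0∞) 0) := by
    simp only [scaledMean, Subsingleton.elim _ (0 : Fin 0 → ℝ≥0∞)]
    simp
  have hl (x : ℝ≥0∞) : tailMean G 0 f x = f (Fin.cons x 0) := by
    simp only [tailMean, Subsingleton.elim _ (0 : Fin 0 → ℝ≥0∞)]
    simp
  have hc : Continuous fun x : ℝ≥0 => f (Fin.cons (x : ℝ≥0∞) 0) :=
    f.continuous.comp (Continuous.finCons ENNReal.continuous_coe continuous_const)
  simp only [hs, hl]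
  refine ⟨fun z _ => (hc.tendsto z).comp tendsto_snd, ?_⟩
  exact_mod_cast (hc.tendsto 0).comp (tendsto_snd.mono_right hL0)

lemma tendsto_scaledMean {K : Kernel ℝ≥0 ℝ≥0} [IsMarkovKernel K]
    {G : Measure ℝ≥0} [IsProbabilityMeasure G] (hK : KernelDOA K G)
    (hcase : G {0} = 0 ∨ ExtremalBoundary K G (fun _ => 0) ∨ RegCond K) (m : ℕ)
    (f : C(Fin (m + 1) → ℝ≥0∞, ℝ)) {z : ℝ≥0} (hz : 0 < z) :
    Tendsto (fun p : ℝ≥0 × ℝ≥0 => scaledMean K m f p.1 p.2)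
      (atTop ×ˢ 𝓝 z) (𝓝 (tailMean G m f z)) := by
  have hmapW {x : ℝ≥0} (hx : 0 < x) (φ : C(ℝ≥0∞, ℝ)) :
      Tendsto (fun p : ℝ≥0 × ℝ≥0 => ∫ z, φ (z : ℝ≥0∞) ∂((K (p.1 * p.2)).map (· / p.1)))
        (atTop ×ˢ 𝓝 x) (𝓝 (∫ z, φ (z : ℝ≥0∞) ∂(G.map (x * ·)))) := by
    have hcoe (μ : Measure ℝ≥0) : AEStronglyMeasurable (fun z : ℝ≥0 => φ z) μ :=
      (φ.continuous.measurable.comp measurable_coe_nnreal_ennreal).aestronglyMeasurable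
    rw [integral_map (by fun_prop) (hcoe _)]
    simp only [ENNReal.coe_mul]
    refine (hK.tendsto_prod_nhds hx φ).congr fun p => ?_
    rw [integral_map (by fun_prop) (hcoe _)]
  have hρ (p : ℝ≥0 × ℝ≥0) : IsProbabilityMeasure ((K (p.1 * p.2)).map (· / p.1)) :=
    Measure.isProbabilityMeasure_map (by fun_prop)
  have hρ' (x : ℝ≥0) : IsProbabilityMeasure (G.map (x * ·)) :=
    Measure.isProbabilityMeasure_map (by fun_prop)
  have hreal {x : ℝ≥0} (hx : 0 < x) : (G.map (x * ·)).real {0} = G.real {0} := by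
    rw [map_measureReal_apply (by fun_prop) (measurableSet_singleton _)]
    congr 1
    ext y
    simp [hx.ne']
  have main (m : ℕ) (S : Set ℝ≥0) (hS : S ⊆ {0})
      (hlim : ∀ x : ℝ≥0, 0 < x → Tendsto (fun p : ℝ≥0 × ℝ≥0 =>
        ((K (p.1 * p.2)).map (· / p.1)).real S) (atTop ×ˢ 𝓝 x) (𝓝 (G.real {0})))
      (hzero : ∀ m, ∀ f : C(Fin (m + 1) → ℝ≥0∞, ℝ),
        Tendsto (fun p : ℝ≥0 × ℝ≥0 => scaledMean K m f p.1 p.2)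
          (atTop ×ˢ 𝓟 S) (𝓝 (tailMean G m f 0))) :
      ScaledMeanTendsto K G (𝓟 S) m := by
    have hL0 : 𝓟 S ≤ 𝓝 0 := (principal_mono.2 hS).trans (by simp)
    induction m with
    | zero => exact scaledMeanTendsto_zero K G hL0
    | succ m ih =>
      refine fun f => ⟨fun x hx => ?_, hzero _ f⟩
      refine ih.succ hL0 le_rfl (hK.tendsto_prod_nhds hx) ?_ f
      intro V hV η hη
      obtain ⟨δ, hδ, h⟩ := exists_real_Iio_diff_le (hmapW hx) hS
        (by rw [hreal hx]; exact hlim x hx) hη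
      refine ⟨δ, hδ, h.mono fun p hp => (measureReal_mono ?_).trans hp⟩
      exact Set.sdiff_subset_sdiff_right (mem_principal.1 hV)
  rcases hcase with hG | hE | hR
  · refine (main m ∅ (Set.empty_subset _) (fun x _ => ?_) (fun m f => ?_) f).1 z hz
    · simp [Measure.real, hG]
    · simp
  · refine (main m {0} le_rfl (fun x hx => ?_) (fun m f => ?_) f).1 z hz
    · have h := ((ENNReal.tendsto_toReal (measure_ne_top G {0})).comp hE.2).comp
        (tendsto_mul_prod_nhds hx)
      refine h.congr' ?_
      have hpos : ∀ᶠ p : ℝ≥0 × ℝ≥0 in atTop ×ˢ 𝓝 x, p.1 ≠ 0 := tendsto_fst.eventually_ne_atTop 0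
      filter_upwards [hpos] with p hp
      rw [map_measureReal_apply (by fun_prop) (measurableSet_singleton _)]
      simp only [Function.comp_apply, mul_zero, Measure.real]
      congr 2
      ext y
      simp [hp]
    · rw [tailMean_zero_right, principal_singleton, prod_pure, tendsto_map'_iff]
      exact tendsto_scaledMean_zero_right K m f
  · suffices h : ScaledMeanTendsto K G (𝓝 0) m from (h f).1 z hz
    clear f main
    induction m with
    | zero => exact scaledMeanTendsto_zero K G le_rfl
    | succ m ih =>
      have hL {Λ : Filter ℝ≥0} : ∀ V ∈ 𝓝 (0 : ℝ≥0), ∀ η : ℝ, 0 < η → ∃ δ > 0,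
          ∀ᶠ p : ℝ≥0 × ℝ≥0 in atTop ×ˢ Λ,
            ((K (p.1 * p.2)).map (· / p.1)).real (Set.Iio δ \ V) ≤ η := by
        intro V hV η hη
        obtain ⟨δ, hδ, hδV⟩ := (nhds_bot_basis (α := ℝ≥0)).mem_iff.1 hV
        refine ⟨δ, hδ, Eventually.of_forall fun p => ?_⟩
        rw [Set.sdiff_eq_empty.2 hδV]
        simpa using hη.le
      refine fun f => ⟨fun x hx => ih.succ le_rfl le_rfl (hK.tendsto_prod_nhds hx) hL f, ?_⟩
      exact_mod_cast ih.succ le_rfl le_rfl (x := 0)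
        (fun φ => by simpa using hR.tendsto_prod_nhds φ) hL f

section

variable {α : ℝ} {να : Measure ℝ≥0∞}

lemma measure_singleton_top_eq_zero (hα : 0 < α)
    (htail : ∀ x : ℝ≥0, 0 < x →
      να (Set.Ioi (x : ℝ≥0∞)) = ENNReal.ofReal ((x : ℝ) ^ (-α))) : να {⊤} = 0 := by
  have h1 : Tendsto (fun x : ℝ≥0 => ENNReal.ofReal ((x : ℝ) ^ (-α))) atTop (𝓝 0) := by
    rw [← ENNReal.ofReal_zero]
    exact (ENNReal.continuous_ofReal.tendsto 0).comp
      ((tendsto_rpow_neg_atTop hα).comp (NNReal.tendsto_coe_atTop.2 tendsto_id))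
  refine le_antisymm (ge_of_tendsto h1 ?_) zero_le
  filter_upwards [eventually_gt_atTop 0] with x hx
  rw [← htail x hx]
  exact measure_mono (by simp)

lemma integrable_bump
    (htail : ∀ x : ℝ≥0, 0 < x →
      να (Set.Ioi (x : ℝ≥0∞)) = ENNReal.ofReal ((x : ℝ) ^ (-α))) {c : ℝ≥0} (hc : 0 < c) :
    Integrable (bump c) να := by
  have hfin : να (Set.Ioi ((c⁻¹ : ℝ≥0) : ℝ≥0∞)) ≠ ⊤ := by
    rw [htail _ (inv_pos.2 hc)]
    exact ENNReal.ofReal_ne_top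
  have hI : Integrable ((Set.Ioi ((c⁻¹ : ℝ≥0) : ℝ≥0∞)).indicator fun _ => (1 : ℝ)) να :=
    (integrable_indicator_iff measurableSet_Ioi).2 (integrableOn_const hfin)
  refine hI.mono' (bump c).continuous.measurable.aestronglyMeasurable (ae_of_all _ fun z => ?_)
  rw [Real.norm_eq_abs]
  by_cases hz : z ∈ Set.Ioi ((c⁻¹ : ℝ≥0) : ℝ≥0∞)
  · rw [Set.indicator_of_mem hz]
    exact abs_bump_le_one c z
  · rw [bump_eq_zero]
    · simpa using Set.indicator_nonneg (fun _ _ => zero_le_one) _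
    · calc (c : ℝ≥0∞) * z ≤ c * ((c⁻¹ : ℝ≥0) : ℝ≥0∞) := by gcongr; exact not_lt.1 hz
        _ = 1 := by rw [← ENNReal.coe_mul, mul_inv_cancel₀ hc.ne', ENNReal.coe_one]

lemma bump_mono {c d : ℝ≥0} (h : c ≤ d) (z : ℝ≥0∞) : bump c z ≤ bump d z := by
  refine ENNReal.toReal_mono (ne_top_of_le_ne_top ENNReal.one_ne_top (min_le_right _ _)) ?_
  gcongr

lemma tendsto_integral_bump_inv_of_tail (hα : 0 < α)
    (htail : ∀ x : ℝ≥0, 0 < x →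
      να (Set.Ioi (x : ℝ≥0∞)) = ENNReal.ofReal ((x : ℝ) ^ (-α))) :
    Tendsto (fun n : ℕ => ∫ z, bump (n + 1 : ℝ≥0)⁻¹ z ∂να) atTop (𝓝 0) := by
  have hae : ∀ᵐ z ∂να, z ≠ ⊤ := by
    rw [ae_iff]
    simpa using measure_singleton_top_eq_zero hα htail
  simpa using tendsto_integral_of_dominated_convergence (μ := να)
    (F := fun (n : ℕ) (z : ℝ≥0∞) => bump (n + 1 : ℝ≥0)⁻¹ z) (f := fun _ => 0) (bump 1)
    (fun n => (bump _).continuous.measurable.aestronglyMeasurable)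
    (integrable_bump htail one_pos)
    (fun n => ae_of_all _ fun z => by
      rw [Real.norm_eq_abs, abs_of_nonneg (bump_nonneg _ z)]
      exact bump_mono (inv_le_one_of_one_le₀ (by simp)) z)
    (hae.mono fun z hz => by
      lift z to ℝ≥0 using hz
      exact tendsto_bump_inv_natCast z)

end

lemma tailMean_eq_zero {G : Measure ℝ≥0} {m : ℕ} {f : C(Fin (m + 1) → ℝ≥0∞, ℝ)} {x : ℝ≥0∞}
    (h : ∀ w : Fin (m + 1) → ℝ≥0∞, w 0 = x → f w = 0) : tailMean G m f x = 0 := by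
  rw [tailMean, integral_congr_ae (ae_of_all _ fun ξ => h _ (Fin.cons_zero _ _)), integral_zero]

lemma scaledMean_eq_zero {K : Kernel ℝ≥0 ℝ≥0} {m : ℕ} {f : C(Fin (m + 1) → ℝ≥0∞, ℝ)}
    {x : ℝ≥0} (h : ∀ w : Fin (m + 1) → ℝ≥0∞, w 0 = x → f w = 0) (t : ℝ≥0) :
    scaledMean K m f t x = 0 := by
  rw [scaledMean, integral_congr_ae (ae_of_all _ fun ξ => h _ (Fin.cons_zero _ _)), integral_zero]

lemma eventually_abs_scaledMean_sub_tailMean_le {K : Kernel ℝ≥0 ℝ≥0} [IsMarkovKernel K]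
    {G : Measure ℝ≥0} [IsProbabilityMeasure G] {m : ℕ} {f : C(Fin (m + 1) → ℝ≥0∞, ℝ)}
    (hconv : ∀ z : ℝ≥0, 0 < z → Tendsto (fun p : ℝ≥0 × ℝ≥0 => scaledMean K m f p.1 p.2)
      (atTop ×ˢ 𝓝 z) (𝓝 (tailMean G m f z)))
    {a : ℝ≥0} (ha : 0 < a) (hsupp : ∀ x, f x ≠ 0 → (a : ℝ≥0∞) ≤ x 0)
    {ε : ℝ} (hε : 0 < ε) (n : ℕ) :
    ∀ᶠ s : ℝ≥0 in atTop, ∀ z : ℝ≥0, |scaledMean K m f s z - tailMean G m f z|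
      ≤ ε * bump (2 / a) z + 2 * ‖f‖ * bump (n + 1 : ℝ≥0)⁻¹ z := by
  have hc : Continuous fun z : ℝ≥0 => tailMean G m f z :=
    (continuous_tailMean G m f).comp ENNReal.continuous_coe
  have hP : {p : ℝ≥0 × ℝ≥0 | |scaledMean K m f p.1 p.2 - tailMean G m f p.2| < ε}
      ∈ atTop ×ˢ 𝓝ˢ (Set.Icc a (2 * (n + 1))) := by
    refine isCompact_Icc.mem_prod_nhdsSet_of_forall fun z hz => ?_
    have h := ((hconv z (ha.trans_le hz.1)).sub ((hc.tendsto z).comp tendsto_snd)).abs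
    simp only [sub_self, abs_zero] at h
    exact h.eventually_lt_const hε
  obtain ⟨U, hU, W, hW, hUW⟩ := mem_prod_iff.1 hP
  filter_upwards [hU] with s hs z
  have hb1 := mul_nonneg hε.le (bump_nonneg (2 / a) z)
  have hb2 := mul_nonneg (mul_nonneg zero_le_two (norm_nonneg f)) (bump_nonneg (n + 1 : ℝ≥0)⁻¹ z)
  rcases lt_or_ge z a with hz | hz
  · have h0 (w : Fin (m + 1) → ℝ≥0∞) (hw : w 0 = z) : f w = 0 := by
      by_contra hne
      have := hsupp w hne
      rw [hw] at this
      exact absurd hz (not_lt.2 (by exact_mod_cast this))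
    rw [scaledMean_eq_zero h0, tailMean_eq_zero h0]
    simpa using add_nonneg hb1 hb2
  rcases le_or_gt z (2 * (n + 1)) with hz' | hz'
  · have h1 : bump (2 / a) (z : ℝ≥0∞) = 1 := by
      refine bump_eq_one ?_
      have : 2 ≤ 2 / a * z := by
        rw [div_mul_eq_mul_div, le_div_iff₀ ha]
        gcongr
      exact_mod_cast this
    have h2 : |scaledMean K m f s z - tailMean G m f z| < ε :=
      hUW (Set.mk_mem_prod hs (subset_of_mem_nhdsSet hW ⟨hz, hz'⟩))
    rw [h1]
    linarith
  · have h1 : bump (n + 1 : ℝ≥0)⁻¹ (z : ℝ≥0∞) = 1 := by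
      refine bump_eq_one ?_
      have : 2 ≤ (n + 1 : ℝ≥0)⁻¹ * z := by
        rw [le_inv_mul_iff₀ (by positivity), mul_comm]
        exact hz'.le
      exact_mod_cast this
    have h2 := abs_sub (scaledMean K m f s z) (tailMean G m f z)
    have h3 := abs_scaledMean_le K m f s z
    have h4 := abs_tailMean_le G m f z
    rw [h1]
    linarith

lemma integral_jointLaw0_div (K : Kernel ℝ≥0 ℝ≥0) [IsMarkovKernel K] (m : ℕ) (H0 : Measure ℝ≥0)
    [IsProbabilityMeasure H0] (f : C(Fin (m + 1) → ℝ≥0∞, ℝ)) {s : ℝ≥0} (hs : s ≠ 0) :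
    ∫ x, f (fun i => ((x i / s : ℝ≥0) : ℝ≥0∞)) ∂(jointLaw0 K m H0)
      = ∫ x, scaledMean K m f s (x / s) ∂H0 := by
  rw [integral_jointLaw0 K m H0 (F := fun x => f (fun i => ((x i / s : ℝ≥0) : ℝ≥0∞)))
    (f.continuous.measurable.comp (measurable_coe_div s)) (fun _ => abs_apply_le_norm f _)]
  refine integral_congr_ae (ae_of_all _ fun x => ?_)
  simp only [scaledMean, mul_div_cancel₀ x hs]
  refine integral_congr_ae (ae_of_all _ fun y => ?_)
  simp only
  congr 1
  funext i
  refine Fin.cases ?_ (fun k => ?_) i <;> simp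

/-- If the chain starts from a regularly varying initial distribution `H0`
(`t H0(b(t)·) → ν_α` vaguely on `(0,∞]`), and either `G({0}) = 0`, or `γ ≡ 0` is an
extremal boundary for `K`, or `K` satisfies the regularity condition, then
`t P[(X_0/b(t), …, X_m/b(t)) ∈ ·] → ν*` vaguely in `M_+(E_m)`, where
`E_m = (0,∞] × [0,∞]^m` and `ν*(dx_0,dx) = ν_α(dx_0) P_{x_0}[(T*_1,…,T*_m) ∈ dx]`. -/
theorem unconditional_fdd_regular_variation (K : Kernel ℝ≥0 ℝ≥0) [IsMarkovKernel K]
    (G : Measure ℝ≥0) [IsProbabilityMeasure G] (hK : KernelDOA K G)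
    (hcase : G {0} = 0 ∨ ExtremalBoundary K G (fun _ => 0) ∨ RegCond K)
    (H0 : Measure ℝ≥0) [IsProbabilityMeasure H0]
    (b : ℝ≥0 → ℝ≥0) (hb : Tendsto b atTop atTop)
    (α : ℝ) (hα : 0 < α)
    (να : Measure ℝ≥0∞) (hνα0 : να {0} = 0)
    (hναtail : ∀ x : ℝ≥0, 0 < x →
      να (Set.Ioi (x : ℝ≥0∞)) = ENNReal.ofReal ((x : ℝ) ^ (-α)))
    (hH0 : ∀ f : C(ℝ≥0∞, ℝ), (∀ y, 0 ≤ f y) →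
      (∃ a : ℝ≥0∞, 0 < a ∧ ∀ y, f y ≠ 0 → a ≤ y) →
      Tendsto (fun t : ℝ≥0 => (t : ℝ) * ∫ x, f ((x / b t : ℝ≥0) : ℝ≥0∞) ∂H0)
        atTop (𝓝 (∫ y, f y ∂να)))
    (m : ℕ) (hm : 1 ≤ m)
    (f : C((Fin (m + 1) → ℝ≥0∞), ℝ)) (hf0 : ∀ x, 0 ≤ f x)
    (hfsupp : ∃ a : ℝ≥0∞, 0 < a ∧ ∀ x, f x ≠ 0 → a ≤ x 0) :
    Tendsto (fun t : ℝ≥0 =>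
        (t : ℝ) * ∫ x, f (fun i => ((x i / b t : ℝ≥0) : ℝ≥0∞)) ∂(jointLaw0 K m H0))
      atTop (𝓝 (∫ x, f x ∂(nuStar G m να))) := by
  obtain ⟨a₀, ha₀, hsupp₀⟩ := hfsupp
  obtain ⟨a, ha, haa₀⟩ : ∃ a : ℝ≥0, 0 < a ∧ (a : ℝ≥0∞) ≤ a₀ := by
    obtain ⟨a, ha, haa⟩ := ENNReal.lt_iff_exists_nnreal_btwn.1 ha₀
    exact ⟨a, by exact_mod_cast ha, haa.le⟩
  have hsupp (x) (hx : f x ≠ 0) : (a : ℝ≥0∞) ≤ x 0 := haa₀.trans (hsupp₀ x hx)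
  rw [integral_nuStar G m να f hf0]
  set g : C(ℝ≥0∞, ℝ) := ⟨tailMean G m f, continuous_tailMean G m f⟩
  have hlim : Tendsto (fun t : ℝ≥0 => (t : ℝ) * ∫ x, g ((x / b t : ℝ≥0) : ℝ≥0∞) ∂H0)
      atTop (𝓝 (∫ y, g y ∂να)) := by
    refine hH0 g (fun y => integral_nonneg fun _ => hf0 _) ⟨a, by exact_mod_cast ha, fun y hy => ?_⟩
    by_contra hlt
    exact hy (tailMean_eq_zero fun w hw => by
      by_contra hne
      exact hlt (hw ▸ hsupp w hne))
  have hbump {c : ℝ≥0} (hc : 0 < c) :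
      Tendsto (fun t : ℝ≥0 => (t : ℝ) * ∫ x, bump c ((x / b t : ℝ≥0) : ℝ≥0∞) ∂H0)
        atTop (𝓝 (∫ y, bump c y ∂να)) := by
    refine hH0 _ (bump_nonneg c) ⟨(c⁻¹ : ℝ≥0), by simpa using hc, fun y hy => ?_⟩
    by_contra hlt
    refine hy (bump_eq_zero ?_)
    calc (c : ℝ≥0∞) * y ≤ c * ((c⁻¹ : ℝ≥0) : ℝ≥0∞) := by gcongr; exact (not_le.1 hlt).le
      _ = 1 := by rw [← ENNReal.coe_mul, mul_inv_cancel₀ hc.ne', ENNReal.coe_one]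
  refine tendsto_of_tendsto_of_dist hlim ?_
  rw [Metric.tendsto_nhds]
  intro ε hε
  set A : ℝ := ∫ y, bump (2 / a) y ∂να with hA
  have hA0 : 0 ≤ A := integral_nonneg (bump_nonneg _)
  set η : ℝ := ε / (2 * (A + 1)) with hη
  have hη0 : 0 < η := by positivity
  obtain ⟨n, hn⟩ := ((tendsto_integral_bump_inv_of_tail hα hναtail).eventually_lt_const
    (show (0 : ℝ) < ε / (4 * (‖f‖ + 1)) by positivity)).exists
  have hev := hb.eventually (eventually_abs_scaledMean_sub_tailMean_le
    (fun z hz => tendsto_scaledMean hK hcase m f hz) ha hsupp hη0 n)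
  filter_upwards [hev, hb.eventually_ne_atTop 0,
    (hbump (c := 2 / a) (by positivity)).eventually_lt_const (show A < A + 1 by linarith),
    (hbump (c := (n + 1 : ℝ≥0)⁻¹) (by positivity)).eventually_lt_const hn] with t ht hbt ht1 ht2
  have hm : Measurable fun x : ℝ≥0 => ((x / b t : ℝ≥0) : ℝ≥0∞) := by fun_prop
  have hi (ψ : C(ℝ≥0∞, ℝ)) : Integrable (fun x : ℝ≥0 => ψ ((x / b t : ℝ≥0) : ℝ≥0∞)) H0 :=
    Integrable.of_bound (ψ.continuous.measurable.comp hm).aestronglyMeasurable ‖ψ‖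
      (ae_of_all _ fun _ => abs_apply_le_norm ψ _)
  have hs : Integrable (fun x : ℝ≥0 => scaledMean K m f (b t) (x / b t)) H0 :=
    Integrable.of_bound ((measurable_scaledMean K m f (b t)).comp
      (measurable_id.div_const _)).aestronglyMeasurable ‖f‖
      (ae_of_all _ fun _ => abs_scaledMean_le K m f _ _)
  have hint : |∫ x, (scaledMean K m f (b t) (x / b t) - g ((x / b t : ℝ≥0) : ℝ≥0∞)) ∂H0|
      ≤ η * ∫ x, bump (2 / a) ((x / b t : ℝ≥0) : ℝ≥0∞) ∂H0
        + 2 * ‖f‖ * ∫ x, bump (n + 1 : ℝ≥0)⁻¹ ((x / b t : ℝ≥0) : ℝ≥0∞) ∂H0 := by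
    rw [← integral_const_mul, ← integral_const_mul,
      ← integral_add ((hi _).const_mul _) ((hi _).const_mul _)]
    have hbound := ((hi (bump (2 / a))).const_mul η).add
      ((hi (bump (n + 1 : ℝ≥0)⁻¹)).const_mul (2 * ‖f‖))
    exact norm_integral_le_of_norm_le
      (f := fun x : ℝ≥0 => scaledMean K m f (b t) (x / b t) - g ((x / b t : ℝ≥0) : ℝ≥0∞))
      hbound (ae_of_all _ fun x => ht (x / b t))
  rw [Real.dist_eq, sub_zero, abs_of_nonneg dist_nonneg, dist_comm, Real.dist_eq,
    integral_jointLaw0_div K m H0 f hbt, ← mul_sub, ← integral_sub hs (hi g), abs_mul,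
    abs_of_nonneg (NNReal.coe_nonneg t)]
  have hmul := mul_le_mul_of_nonneg_left hint (NNReal.coe_nonneg t)
  have h1 : η * (t * ∫ x, bump (2 / a) ((x / b t : ℝ≥0) : ℝ≥0∞) ∂H0) ≤ η * (A + 1) := by gcongr
  have h2 : 2 * ‖f‖ * (t * ∫ x, bump (n + 1 : ℝ≥0)⁻¹ ((x / b t : ℝ≥0) : ℝ≥0∞) ∂H0)
      ≤ 2 * ‖f‖ * (ε / (4 * (‖f‖ + 1))) := by gcongr
  have h3 : η * (A + 1) = ε / 2 := by
    rw [hη]; field_simp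
  have h4 : 2 * ‖f‖ * (ε / (4 * (‖f‖ + 1))) < ε / 2 := by
    rw [← mul_div_assoc, div_lt_div_iff₀ (by positivity) two_pos]
    nlinarith [norm_nonneg f]
  linarith
end
end

section
/- For each t > 0 let Y_t = (Y_{t,0}, Y_{t,1}, …, Y_{t,m}) be a random vector on [0,∞]^{m+1}. Then there exists a non-null Radon measure μ* on E*_m = [0,∞]^{m+1} \ {0} with t·P[Y_t ∈ ·] → μ* vaguely in M_+(E*_m) as t → ∞, if and only if for each j = 0, …, m there exist Radon measures μ_{m-j} on E_{m-j} = (0,∞] × [0,∞]^{m-j}, not all null, such that t·P[(Y_{t,j}, …, Y_{t,m}) ∈ ·] → μ_{m-j} vaguely in M_+(E_{m-j}). In that case μ_{m-j}(·) = μ*([0,∞]^j × ·) on E_{m-j} for j = 0, …, m, and for every x ∈ E*_m one has μ*([0,x]^c) = Σ_{j=0}^m μ_{m-j}((x_j,∞] × [0,x_{j+1}] × ⋯ × [0,x_m]). Furthermore, for each j ∈ {0, …, m−1}, if A ⊆ [0,∞]^{m-j} \ {0}^{m-j} is relatively compact, then μ_{m-j}((0,∞] × A) < ∞. -/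
open MeasureTheory ProbabilityTheory Filter Topology
open scoped NNReal ENNReal

noncomputable section

/-- Projection of `[0,∞]^{m+1}` onto the last `m - j + 1` coordinates
`(x_j, …, x_m)`. -/
def projTail (m : ℕ) (j : Fin (m + 1)) (x : Fin (m + 1) → ℝ≥0∞) :
    Fin (m - (j : ℕ) + 1) → ℝ≥0∞ :=
  fun i => x ⟨(j : ℕ) + (i : ℕ), by have hj := j.isLt; have hi := i.isLt; omega⟩

/-- A Radon measure on the cone `E*_m = [0,∞]^{m+1} \ {0}`: it puts no mass at the
origin and is finite on sets bounded away from the origin (the compact subsets of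
`E*_m`). -/
def RadonStar (m : ℕ) (μ : Measure (Fin (m + 1) → ℝ≥0∞)) : Prop :=
  μ {x | ∀ i, x i = 0} = 0 ∧
    ∀ a : ℝ≥0∞, 0 < a → μ {x | ∃ i, a ≤ x i} < ⊤

/-- A Radon measure on the cone `E_k = (0,∞] × [0,∞]^k`: no mass on `{x_0 = 0}` and
finite on `{x_0 ≥ a}` for every `a > 0`. -/
def RadonCone (k : ℕ) (μ : Measure (Fin (k + 1) → ℝ≥0∞)) : Prop :=
  μ {x | x 0 = 0} = 0 ∧ ∀ a : ℝ≥0∞, 0 < a → μ {x | a ≤ x 0} < ⊤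

/-- Vague convergence `t P[Y_t ∈ ·] → μ` in `M_+(E*_m)`, tested against continuous
nonnegative functions supported away from the origin. -/
def VagueStar (m : ℕ) (L : ℝ≥0 → Measure (Fin (m + 1) → ℝ≥0∞))
    (μ : Measure (Fin (m + 1) → ℝ≥0∞)) : Prop :=
  ∀ f : C((Fin (m + 1) → ℝ≥0∞), ℝ), (∀ x, 0 ≤ f x) →
    (∃ a : ℝ≥0∞, 0 < a ∧ ∀ x, f x ≠ 0 → ∃ i, a ≤ x i) →
    Tendsto (fun t : ℝ≥0 => (t : ℝ) * ∫ x, f x ∂(L t))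
      atTop (𝓝 (∫ x, f x ∂μ))

/-- Vague convergence `t P[(Y_{t,j}, …, Y_{t,m}) ∈ ·] → μ` in `M_+(E_{m-j})`, where
`E_{m-j} = (0,∞] × [0,∞]^{m-j}`, tested against continuous nonnegative functions
supported away from `{x_0 = 0}`. -/
def VagueCone (m : ℕ) (j : Fin (m + 1)) (L : ℝ≥0 → Measure (Fin (m + 1) → ℝ≥0∞))
    (μ : Measure (Fin (m - (j : ℕ) + 1) → ℝ≥0∞)) : Prop :=
  ∀ f : C((Fin (m - (j : ℕ) + 1) → ℝ≥0∞), ℝ), (∀ x, 0 ≤ f x) →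
    (∃ a : ℝ≥0∞, 0 < a ∧ ∀ x, f x ≠ 0 → a ≤ x 0) →
    Tendsto (fun t : ℝ≥0 => (t : ℝ) * ∫ x, f (projTail m j x) ∂(L t))
      atTop (𝓝 (∫ x, f x ∂μ))

/-- The continuous function `s ↦ min 1 (s - a)` on `[0,∞]`, with real values. -/
def ramp (a : ℝ≥0∞) : C(ℝ≥0∞, ℝ) where
  toFun s := (min 1 (s - a)).toReal
  continuous_toFun := by
    refine ENNReal.continuousOn_toReal.comp_continuous
      (continuous_const.min (ENNReal.continuous_sub_right a)) fun s => ?_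
    exact ne_top_of_le_ne_top ENNReal.one_ne_top (min_le_left _ _)

lemma ramp_apply (a s : ℝ≥0∞) : ramp a s = (min 1 (s - a)).toReal := rfl

lemma ramp_nonneg (a s : ℝ≥0∞) : 0 ≤ ramp a s := ENNReal.toReal_nonneg

lemma ramp_mono (a : ℝ≥0∞) : Monotone (ramp a) := fun s t h => by
  rw [ramp_apply, ramp_apply]
  exact ENNReal.toReal_mono (ne_top_of_le_ne_top ENNReal.one_ne_top (min_le_left _ _))
    (min_le_min le_rfl (tsub_le_tsub_right h a))

lemma ramp_pos {a s : ℝ≥0∞} (h : a < s) : 0 < ramp a s := by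
  rw [ramp_apply]
  refine ENNReal.toReal_pos ?_
    (ne_top_of_le_ne_top ENNReal.one_ne_top (min_le_left _ _))
  exact (lt_min one_pos (tsub_pos_of_lt h)).ne'

lemma le_of_ramp_ne_zero {a s : ℝ≥0∞} (h : ramp a s ≠ 0) : a ≤ s := by
  by_contra! hs
  exact h (by simp [ramp_apply, tsub_eq_zero_of_le hs.le])

lemma ContinuousMap.integrable_of_support_subset {X : Type*} [TopologicalSpace X]
    [CompactSpace X] [MeasurableSpace X] [OpensMeasurableSpace X]
    {μ : Measure X} (f : C(X, ℝ)) {s : Set X} (hμ : μ s < ⊤) (hf : ∀ x, f x ≠ 0 → x ∈ s) :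
    Integrable f μ := by
  have h : IntegrableOn f s μ :=
    Measure.integrableOn_of_bounded hμ.ne f.continuous.measurable.aestronglyMeasurable
      (M := ‖f‖) (Eventually.of_forall fun x => f.norm_coe_le_norm x)
  exact (integrableOn_iff_integrable_of_support_subset fun x hx => hf x hx).1 h

lemma measurableSet_le_coord {n : ℕ} (a : ℝ≥0∞) (i : Fin n) :
    MeasurableSet {x : Fin n → ℝ≥0∞ | a ≤ x i} :=
  measurableSet_le measurable_const (measurable_pi_apply i)

lemma measurableSet_exists_le_coord {n : ℕ} (a : ℝ≥0∞) :
    MeasurableSet {x : Fin n → ℝ≥0∞ | ∃ i, a ≤ x i} := by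
  rw [Set.ofPred_exists]
  exact .iUnion fun i => measurableSet_le_coord a i

lemma measurableSet_pos_coord {n : ℕ} (i : Fin n) :
    MeasurableSet {x : Fin n → ℝ≥0∞ | 0 < x i} :=
  measurableSet_lt measurable_const (measurable_pi_apply i)

lemma RadonCone.integrable {k : ℕ} {μ : Measure (Fin (k + 1) → ℝ≥0∞)} (hμ : RadonCone k μ)
    (f : C((Fin (k + 1) → ℝ≥0∞), ℝ)) {a : ℝ≥0∞} (ha : 0 < a)
    (hf : ∀ x, f x ≠ 0 → a ≤ x 0) : Integrable f μ :=
  f.integrable_of_support_subset (hμ.2 a ha) hf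

/-- Two Radon measures on `(0,∞] × [0,∞]^k` with the same integrals of continuous nonnegative
compactly supported functions agree on measurable subsets of the cone. -/
lemma RadonCone.measure_eq {k : ℕ} {μ ν : Measure (Fin (k + 1) → ℝ≥0∞)}
    (hμ : RadonCone k μ) (hν : RadonCone k ν)
    (h : ∀ f : C((Fin (k + 1) → ℝ≥0∞), ℝ), (∀ x, 0 ≤ f x) →
      (∃ a : ℝ≥0∞, 0 < a ∧ ∀ x, f x ≠ 0 → a ≤ x 0) → ∫ x, f x ∂μ = ∫ x, f x ∂ν)
    {B : Set (Fin (k + 1) → ℝ≥0∞)} (hB : MeasurableSet B) (hB0 : ∀ x ∈ B, 0 < x 0) :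
    μ B = ν B := by
  have key : ∀ a : ℝ≥0∞, 0 < a → μ (B ∩ {x | a < x 0}) = ν (B ∩ {x | a < x 0}) := by
    intro a ha
    set w : (Fin (k + 1) → ℝ≥0∞) → ℝ≥0∞ := fun x => ENNReal.ofReal (ramp a (x 0)) with hw
    have hwm : Measurable w :=
      ((ramp a).continuous.measurable.comp (measurable_pi_apply 0)).ennreal_ofReal
    let r : C((Fin (k + 1) → ℝ≥0∞), ℝ) := ⟨fun x => ramp a (x 0), by fun_prop⟩
    have hr : ∀ x, r x ≠ 0 → a ≤ x 0 := fun x hx => le_of_ramp_ne_zero hx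
    have hfin : ∀ {ρ : Measure (Fin (k + 1) → ℝ≥0∞)}, RadonCone k ρ →
        IsFiniteMeasure (ρ.withDensity w) := fun {ρ} hρ =>
      isFiniteMeasure_withDensity_ofReal (hρ.integrable r ha hr).2
    have := hfin hμ
    have := hfin hν
    have heq : μ.withDensity w = ν.withDensity w := by
      refine ext_of_forall_lintegral_eq_of_IsFiniteMeasure fun g => ?_
      have hg : Measurable fun x => (g x : ℝ≥0∞) :=
        (g.continuous.measurable).coe_nnreal_ennreal
      rw [lintegral_withDensity_eq_lintegral_mul _ hwm hg,
        lintegral_withDensity_eq_lintegral_mul _ hwm hg]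
      let f : C((Fin (k + 1) → ℝ≥0∞), ℝ) :=
        ⟨fun x => ramp a (x 0) * (g x : ℝ), by fun_prop⟩
      have hf0 : ∀ x, 0 ≤ f x := fun x => mul_nonneg (ramp_nonneg _ _) (g x).2
      have hfs : ∀ x, f x ≠ 0 → a ≤ x 0 := fun x hx =>
        le_of_ramp_ne_zero (left_ne_zero_of_mul hx)
      have hval : (w * fun x => (g x : ℝ≥0∞)) = fun x => ENNReal.ofReal (f x) := by
        funext x
        simp [f, hw, ENNReal.ofReal_mul (ramp_nonneg _ _)]
      rw [hval, ← ofReal_integral_eq_lintegral_ofReal (hμ.integrable f ha hfs)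
          (Eventually.of_forall hf0),
        ← ofReal_integral_eq_lintegral_ofReal (hν.integrable f ha hfs)
          (Eventually.of_forall hf0), h f hf0 ⟨a, ha, hfs⟩]
    have hS : MeasurableSet (B ∩ {x | a < x 0}) :=
      hB.inter (measurableSet_lt measurable_const (measurable_pi_apply 0))
    have hcomp : ∀ ρ : Measure (Fin (k + 1) → ℝ≥0∞), ρ (B ∩ {x | a < x 0}) =
        ∫⁻ x, (B ∩ {x | a < x 0}).indicator (fun x => (w x)⁻¹) x ∂(ρ.withDensity w) := by
      intro ρ
      rw [lintegral_withDensity_eq_lintegral_mul _ hwm (Measurable.indicator (f := fun x => (w x)⁻¹) hwm.inv hS),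
        ← lintegral_indicator_one hS]
      refine lintegral_congr fun x => ?_
      by_cases hx : x ∈ B ∩ {x | a < x 0}
      · simp only [Set.indicator_of_mem hx, Pi.mul_apply, Pi.one_apply]
        rw [ENNReal.mul_inv_cancel _ ENNReal.ofReal_ne_top]
        exact (ENNReal.ofReal_pos.2 (ramp_pos hx.2)).ne'
      · simp [Set.indicator_of_notMem hx]
    rw [hcomp μ, hcomp ν, heq]
  obtain ⟨u, hu, hu0, hulim⟩ := exists_seq_strictAnti_tendsto' (zero_lt_one' ℝ≥0∞)
  have hBu : B = ⋃ n, B ∩ {x | u n < x 0} := by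
    rw [← Set.inter_iUnion]
    refine (Set.inter_eq_left.2 fun x hx => ?_).symm
    obtain ⟨n, hn⟩ := (hulim.eventually (gt_mem_nhds (hB0 x hx))).exists
    exact Set.mem_iUnion.2 ⟨n, hn⟩
  have hmono : Monotone fun n => B ∩ {x | u n < x 0} := fun p q hpq =>
    Set.inter_subset_inter_right _ fun x (hx : u p < x 0) =>
      (hu.antitone hpq).trans_lt hx
  rw [hBu, hmono.measure_iUnion, hmono.measure_iUnion]
  exact iSup_congr fun n => key _ (hu0 n).1

lemma RadonCone.eq_zero {k : ℕ} {μ : Measure (Fin (k + 1) → ℝ≥0∞)} (hμ : RadonCone k μ)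
    (h : ∀ f : C((Fin (k + 1) → ℝ≥0∞), ℝ), (∀ x, 0 ≤ f x) →
      (∃ a : ℝ≥0∞, 0 < a ∧ ∀ x, f x ≠ 0 → a ≤ x 0) → ∫ x, f x ∂μ = 0) : μ = 0 := by
  have h1 : μ {x | 0 < x 0} = 0 := by
    have h0 : RadonCone k (0 : Measure (Fin (k + 1) → ℝ≥0∞)) := by simp [RadonCone]
    simpa using hμ.measure_eq h0 (fun f hf hs => by simpa using h f hf hs)
      (measurableSet_pos_coord 0) fun x hx => hx
  rw [← Measure.measure_univ_eq_zero]
  refine measure_mono_null (fun x _ => ?_) (measure_union_null hμ.1 h1)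
  rcases eq_zero_or_pos (x 0) with hx | hx
  · exact .inl hx
  · exact .inr hx

lemma continuous_projTail (m : ℕ) (j : Fin (m + 1)) : Continuous (projTail m j) :=
  continuous_pi fun _ => continuous_apply _

lemma projTail_zero (m : ℕ) (j : Fin (m + 1)) (x : Fin (m + 1) → ℝ≥0∞) :
    projTail m j x 0 = x j := rfl

/-- The limit measure induced on the sub-cone `(0,∞] × [0,∞]^{m-j}` by a measure on
`[0,∞]^{m+1}`. -/
def tailMeasure (m : ℕ) (j : Fin (m + 1)) (μ : Measure (Fin (m + 1) → ℝ≥0∞)) :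
    Measure (Fin (m - (j : ℕ) + 1) → ℝ≥0∞) :=
  (μ.map (projTail m j)).restrict {x | 0 < x 0}

lemma tailMeasure_apply {m : ℕ} {j : Fin (m + 1)} (μ : Measure (Fin (m + 1) → ℝ≥0∞))
    {B : Set (Fin (m - (j : ℕ) + 1) → ℝ≥0∞)} (hB : MeasurableSet B) :
    tailMeasure m j μ B = μ (projTail m j ⁻¹' (B ∩ {x | 0 < x 0})) := by
  rw [tailMeasure, Measure.restrict_apply hB,
    Measure.map_apply (continuous_projTail m j).measurable (hB.inter (measurableSet_pos_coord 0))]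

lemma integral_tailMeasure {m : ℕ} {j : Fin (m + 1)} (μ : Measure (Fin (m + 1) → ℝ≥0∞))
    (f : C((Fin (m - (j : ℕ) + 1) → ℝ≥0∞), ℝ))
    (hf : ∃ a : ℝ≥0∞, 0 < a ∧ ∀ x, f x ≠ 0 → a ≤ x 0) :
    ∫ x, f x ∂(tailMeasure m j μ) = ∫ x, f (projTail m j x) ∂μ := by
  obtain ⟨a, ha, hf⟩ := hf
  rw [tailMeasure, setIntegral_eq_integral_of_forall_compl_eq_zero,
    integral_map (continuous_projTail m j).aemeasurable
      f.continuous.measurable.aestronglyMeasurable]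
  intro x hx
  by_contra h
  exact hx (ha.trans_le (hf x h))

lemma RadonStar.radonCone_tailMeasure {m : ℕ} {μ : Measure (Fin (m + 1) → ℝ≥0∞)} (hμ : RadonStar m μ)
    (j : Fin (m + 1)) : RadonCone (m - (j : ℕ)) (tailMeasure m j μ) := by
  refine ⟨?_, fun a ha => ?_⟩
  · rw [tailMeasure_apply _ (measurableSet_eq_fun (measurable_pi_apply 0) measurable_const)]
    convert measure_empty (μ := μ)
    ext x
    simp +contextual [pos_iff_ne_zero]
  · rw [tailMeasure_apply _ (measurableSet_le_coord a 0)]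
    refine (measure_mono fun x hx => ?_).trans_lt (hμ.2 a ha)
    exact ⟨j, hx.1⟩

lemma VagueStar.tendsto_projTail {m : ℕ} {L : ℝ≥0 → Measure (Fin (m + 1) → ℝ≥0∞)}
    {μ : Measure (Fin (m + 1) → ℝ≥0∞)} (h : VagueStar m L μ) (j : Fin (m + 1)) :
    VagueCone m j L (tailMeasure m j μ) := by
  intro f hf hs
  rw [integral_tailMeasure μ f hs]
  obtain ⟨a, ha, hs⟩ := hs
  exact h (f.comp ⟨projTail m j, continuous_projTail m j⟩) (fun x => hf _)
    ⟨a, ha, fun x hx => ⟨j, hs _ hx⟩⟩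

lemma RadonStar.exists_tailMeasure_ne_zero {m : ℕ} {μ : Measure (Fin (m + 1) → ℝ≥0∞)}
    (hμ : RadonStar m μ) (h0 : μ ≠ 0) : ∃ j, tailMeasure m j μ ≠ 0 := by
  by_contra! h
  refine h0 ?_
  rw [← Measure.measure_univ_eq_zero]
  have h1 : ∀ j, μ {x | 0 < x j} = 0 := fun j => by
    simpa [h j, projTail_zero] using (tailMeasure_apply (j := j) μ MeasurableSet.univ).symm
  refine measure_mono_null (fun x _ => ?_)
    (measure_union_null hμ.1 (measure_iUnion_null h1))
  by_cases hx : ∀ i, x i = 0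
  · exact .inl hx
  · push Not at hx
    obtain ⟨i, hi⟩ := hx
    exact .inr (Set.mem_iUnion.2 ⟨i, pos_iff_ne_zero.2 hi⟩)

lemma measure_eq_preimage_projTail {m : ℕ} {L : ℝ≥0 → Measure (Fin (m + 1) → ℝ≥0∞)}
    {μ : Measure (Fin (m + 1) → ℝ≥0∞)} (hμ : RadonStar m μ) (hv : VagueStar m L μ)
    {j : Fin (m + 1)} {ν : Measure (Fin (m - (j : ℕ) + 1) → ℝ≥0∞)}
    (hν : RadonCone (m - (j : ℕ)) ν) (hvν : VagueCone m j L ν)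
    {B : Set (Fin (m - (j : ℕ) + 1) → ℝ≥0∞)} (hB : MeasurableSet B) (hB0 : ∀ x ∈ B, 0 < x 0) :
    ν B = μ (projTail m j ⁻¹' B) := by
  rw [hν.measure_eq (hμ.radonCone_tailMeasure j) (fun f hf hs =>
    tendsto_nhds_unique (hvν f hf hs) (hv.tendsto_projTail j f hf hs)) hB hB0,
    tailMeasure_apply μ hB, Set.inter_eq_left.2 (show B ⊆ {x | 0 < x 0} from fun x hx => hB0 x hx)]

/-- The points of `(0,∞] × [0,∞]^{m-j}` whose first coordinate exceeds `x_j` and whose other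
coordinates are bounded by `x_{j+1}, …, x_m`. -/
def lastExceed (m : ℕ) (x : Fin (m + 1) → ℝ≥0∞) (j : Fin (m + 1)) :
    Set (Fin (m - (j : ℕ) + 1) → ℝ≥0∞) :=
  {y | x j < y 0 ∧ ∀ i : Fin (m - (j : ℕ) + 1), (i : ℕ) ≠ 0 → y i ≤ projTail m j x i}

lemma measurableSet_lastExceed (m : ℕ) (x : Fin (m + 1) → ℝ≥0∞) (j : Fin (m + 1)) :
    MeasurableSet (lastExceed m x j) := by
  have h : lastExceed m x j = {y | x j < y 0} ∩
      ⋂ i : Fin (m - (j : ℕ) + 1), ⋂ _ : (i : ℕ) ≠ 0, {y | y i ≤ projTail m j x i} := by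
    ext y
    simp [lastExceed]
  rw [h]
  exact (measurableSet_lt measurable_const (measurable_pi_apply 0)).inter <|
    .iInter fun i => .iInter fun _ => measurableSet_le (measurable_pi_apply i) measurable_const

lemma mem_preimage_lastExceed {m : ℕ} {x y : Fin (m + 1) → ℝ≥0∞} {j : Fin (m + 1)} :
    y ∈ projTail m j ⁻¹' lastExceed m x j ↔ x j < y j ∧ ∀ i, j < i → y i ≤ x i := by
  refine and_congr Iff.rfl ⟨fun h i hi => ?_, fun h i hi => h _ ?_⟩
  · have hi' : (j : ℕ) < i := hi
    have := h ⟨(i : ℕ) - j, by have := i.isLt; omega⟩ (by simp only [ne_eq]; omega)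
    have e : (j : ℕ) + (i - j) = i := by omega
    simpa [projTail, e] using this
  · show (j : ℕ) < j + i
    omega

lemma setOf_not_le_eq_iUnion (m : ℕ) (x : Fin (m + 1) → ℝ≥0∞) :
    {y | ¬ ∀ i, y i ≤ x i} = ⋃ j, projTail m j ⁻¹' lastExceed m x j := by
  ext y
  simp only [Set.mem_iUnion, mem_preimage_lastExceed, Set.mem_ofPred_eq]
  constructor
  · intro h
    push Not at h
    let s : Finset (Fin (m + 1)) := {i | x i < y i}
    have hs : s.Nonempty := by
      obtain ⟨i, hi⟩ := h
      exact ⟨i, by simpa [s] using hi⟩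
    refine ⟨s.max' hs, by simpa [s] using s.max'_mem hs, fun i hi => ?_⟩
    by_contra! hlt
    exact (s.le_max' i (by simpa [s] using hlt)).not_gt hi
  · rintro ⟨j, hj, -⟩ h
    exact (h j).not_gt hj

lemma pairwise_disjoint_preimage_lastExceed (m : ℕ) (x : Fin (m + 1) → ℝ≥0∞) :
    Pairwise (Function.onFun Disjoint fun j => projTail m j ⁻¹' lastExceed m x j) := by
  intro p q hpq
  refine Set.disjoint_left.2 fun y hp hq => ?_
  rw [mem_preimage_lastExceed] at hp hq
  rcases lt_or_gt_of_ne hpq with h | h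
  · exact (hp.2 q h).not_gt hq.1
  · exact (hq.2 p h).not_gt hp.1

lemma measure_not_le_eq_sum {m : ℕ} (μ : Measure (Fin (m + 1) → ℝ≥0∞))
    (x : Fin (m + 1) → ℝ≥0∞) :
    μ {y | ¬ ∀ i, y i ≤ x i} = ∑ j, μ (projTail m j ⁻¹' lastExceed m x j) := by
  rw [setOf_not_le_eq_iUnion, measure_iUnion (pairwise_disjoint_preimage_lastExceed m x)
    fun j => (continuous_projTail m j).measurable (measurableSet_lastExceed m x j), tsum_fintype]

/-- The scaled expectations `t E[f(Y_t)]` have a finite limit as `t → ∞`. -/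
def ScaledConverges {n : ℕ} (L : ℝ≥0 → Measure (Fin n → ℝ≥0∞))
    (f : C((Fin n → ℝ≥0∞), ℝ)) : Prop :=
  ∃ l : ℝ, Tendsto (fun t : ℝ≥0 => (t : ℝ) * ∫ x, f x ∂(L t)) atTop (𝓝 l)

lemma ContinuousMap.integrable_of_isFiniteMeasure {X : Type*} [TopologicalSpace X]
    [CompactSpace X] [MeasurableSpace X] [OpensMeasurableSpace X]
    {μ : Measure X} [IsFiniteMeasure μ] (f : C(X, ℝ)) : Integrable f μ :=
  f.integrable_of_support_subset (measure_lt_top μ Set.univ) fun _ _ => Set.mem_univ _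

lemma ScaledConverges.sub {n : ℕ} {L : ℝ≥0 → Measure (Fin n → ℝ≥0∞)}
    [∀ t, IsProbabilityMeasure (L t)] {f g : C((Fin n → ℝ≥0∞), ℝ)}
    (hf : ScaledConverges L f) (hg : ScaledConverges L g) : ScaledConverges L (f - g) := by
  obtain ⟨a, ha⟩ := hf
  obtain ⟨b, hb⟩ := hg
  refine ⟨a - b, (ha.sub hb).congr fun t => ?_⟩
  rw [← mul_sub, ← integral_sub f.integrable_of_isFiniteMeasure g.integrable_of_isFiniteMeasure]
  rfl

lemma ScaledConverges.sum {n : ℕ} {L : ℝ≥0 → Measure (Fin n → ℝ≥0∞)}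
    [∀ t, IsProbabilityMeasure (L t)] {ι : Type*} (s : Finset ι)
    {f : ι → C((Fin n → ℝ≥0∞), ℝ)} (hf : ∀ i ∈ s, ScaledConverges L (f i)) :
    ScaledConverges L (∑ i ∈ s, f i) := by
  choose! l hl using hf
  refine ⟨∑ i ∈ s, l i, (tendsto_finsetSum s hl).congr fun t => ?_⟩
  rw [← Finset.mul_sum, ← integral_finsetSum s fun i _ =>
    (f i).integrable_of_isFiniteMeasure]
  simp

/-- Vague convergence on the sub-cone gives convergence for test functions of any sign. -/
lemma VagueCone.scaledConverges {m : ℕ} {j : Fin (m + 1)}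
    {L : ℝ≥0 → Measure (Fin (m + 1) → ℝ≥0∞)} [∀ t, IsProbabilityMeasure (L t)]
    {μ : Measure (Fin (m - (j : ℕ) + 1) → ℝ≥0∞)} (h : VagueCone m j L μ)
    (g : C((Fin (m - (j : ℕ) + 1) → ℝ≥0∞), ℝ)) {a : ℝ≥0∞} (ha : 0 < a)
    (hg : ∀ x, g x ≠ 0 → a ≤ x 0) :
    ScaledConverges L (g.comp ⟨projTail m j, continuous_projTail m j⟩) := by
  have hpos : ∀ u : C((Fin (m - (j : ℕ) + 1) → ℝ≥0∞), ℝ), (∀ x, 0 ≤ u x) →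
      (∀ x, u x ≠ 0 → a ≤ x 0) →
      ScaledConverges L (u.comp ⟨projTail m j, continuous_projTail m j⟩) :=
    fun u hu hs => ⟨_, h u hu ⟨a, ha, hs⟩⟩
  have h1 := hpos (g ⊔ 0) (fun x => by simp) fun x hx => hg x fun h0 => hx (by simp [h0])
  have h2 := hpos (-g ⊔ 0) (fun x => by simp) fun x hx => hg x fun h0 => hx (by simp [h0])
  convert h1.sub h2 using 1
  ext x
  simp only [ContinuousMap.comp_apply, ContinuousMap.sub_apply, ContinuousMap.sup_apply,
    ContinuousMap.neg_apply, ContinuousMap.zero_apply]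
  rcases le_total 0 (g (projTail m j x)) with h0 | h0 <;> simp [h0]

/-- Replace the coordinates of index below `j` by `0`. -/
def zeroBelow {n : ℕ} (j : ℕ) (x : Fin n → ℝ≥0∞) : Fin n → ℝ≥0∞ :=
  fun i => if (i : ℕ) < j then 0 else x i

lemma continuous_zeroBelow {n : ℕ} (j : ℕ) : Continuous (zeroBelow (n := n) j) := by
  refine continuous_pi fun i => ?_
  by_cases h : (i : ℕ) < j
  · simpa [zeroBelow, h] using continuous_const
  · simpa [zeroBelow, h] using continuous_apply i

lemma zeroBelow_zeroBelow {n : ℕ} {j k : ℕ} (hjk : j ≤ k) (x : Fin n → ℝ≥0∞) :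
    zeroBelow k (zeroBelow j x) = zeroBelow k x := by
  funext i
  by_cases h : (i : ℕ) < k
  · simp [zeroBelow, h]
  · simp [zeroBelow, h, show ¬ (i : ℕ) < j by omega]

/-- Extend a point of `[0,∞]^{m-j+1}` to `[0,∞]^{m+1}` by `j` leading zeros. -/
def padZeros (m : ℕ) (j : Fin (m + 1)) (y : Fin (m - (j : ℕ) + 1) → ℝ≥0∞) :
    Fin (m + 1) → ℝ≥0∞ :=
  fun i => if (i : ℕ) < j then 0 else y ⟨(i : ℕ) - j, by have := i.isLt; omega⟩

lemma continuous_padZeros (m : ℕ) (j : Fin (m + 1)) : Continuous (padZeros m j) := by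
  refine continuous_pi fun i => ?_
  by_cases h : (i : ℕ) < j
  · simpa [padZeros, h] using continuous_const
  · simpa [padZeros, h] using continuous_apply _

lemma padZeros_projTail (m : ℕ) (j : Fin (m + 1)) (x : Fin (m + 1) → ℝ≥0∞) :
    padZeros m j (projTail m j x) = zeroBelow j x := by
  funext i
  by_cases h : (i : ℕ) < j
  · simp [padZeros, zeroBelow, h]
  · have e : (j : ℕ) + (i - j) = i := by omega
    simp [padZeros, zeroBelow, projTail, h, e]

lemma padZeros_self (m : ℕ) (j : Fin (m + 1)) (y : Fin (m - (j : ℕ) + 1) → ℝ≥0∞) :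
    padZeros m j y j = y 0 := by
  simp [padZeros]

lemma VagueCone.scaledConverges_of_zeroBelow {m : ℕ} {j : Fin (m + 1)}
    {L : ℝ≥0 → Measure (Fin (m + 1) → ℝ≥0∞)} [∀ t, IsProbabilityMeasure (L t)]
    {μ : Measure (Fin (m - (j : ℕ) + 1) → ℝ≥0∞)} (h : VagueCone m j L μ)
    (f : C((Fin (m + 1) → ℝ≥0∞), ℝ)) (hf : ∀ x, f (zeroBelow j x) = f x)
    {a : ℝ≥0∞} (ha : 0 < a) (hs : ∀ x, f x ≠ 0 → a ≤ x j) : ScaledConverges L f := by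
  have h1 := h.scaledConverges (f.comp ⟨padZeros m j, continuous_padZeros m j⟩) ha
    fun y hy => (hs _ hy).trans_eq (padZeros_self m j y)
  convert h1 using 1
  ext x
  simp [padZeros_projTail, hf]

/-- Coordinatewise truncated subtraction of a finite constant. -/
def shiftDown {n : ℕ} (δ : ℝ≥0) (x : Fin n → ℝ≥0∞) : Fin n → ℝ≥0∞ := fun i => x i - δ

lemma continuous_shiftDown_uncurry {n : ℕ} :
    Continuous fun p : ℝ≥0 × (Fin n → ℝ≥0∞) => shiftDown p.1 p.2 := by
  refine continuous_pi fun i => ?_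
  refine ENNReal.continuousOn_sub.comp_continuous
    (f := fun p : ℝ≥0 × (Fin n → ℝ≥0∞) => (p.2 i, (p.1 : ℝ≥0∞))) ?_ fun p => ?_
  · exact ((continuous_apply i).comp continuous_snd).prodMk
      (ENNReal.continuous_coe.comp continuous_fst)
  · simp

lemma shiftDown_zero {n : ℕ} (x : Fin n → ℝ≥0∞) : shiftDown 0 x = x := by
  funext i
  simp [shiftDown]

/-- The family of functions `f(x - δ)`, continuous in `δ` for the uniform norm. -/
def shiftFamily {n : ℕ} (f : C((Fin n → ℝ≥0∞), ℝ)) : C(ℝ≥0, C((Fin n → ℝ≥0∞), ℝ)) :=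
  (f.comp ⟨fun p : ℝ≥0 × (Fin n → ℝ≥0∞) => shiftDown p.1 p.2,
    continuous_shiftDown_uncurry⟩).curry

lemma shiftFamily_apply {n : ℕ} (f : C((Fin n → ℝ≥0∞), ℝ)) (δ : ℝ≥0) (x : Fin n → ℝ≥0∞) :
    shiftFamily f δ x = f (shiftDown δ x) := rfl

lemma shiftFamily_zero {n : ℕ} (f : C((Fin n → ℝ≥0∞), ℝ)) : shiftFamily f 0 = f := by
  ext x
  rw [shiftFamily_apply, shiftDown_zero]

lemma shiftDown_zeroBelow_succ {n : ℕ} {δ : ℝ≥0} {x : Fin n → ℝ≥0∞} {j : Fin n}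
    (h : x j ≤ δ) :
    shiftDown δ (zeroBelow j x) = shiftDown δ (zeroBelow ((j : ℕ) + 1) x) := by
  funext i
  by_cases hi : (i : ℕ) < j
  · simp [shiftDown, zeroBelow, hi, show (i : ℕ) < j + 1 by omega]
  · by_cases hij : i = j
    · subst hij
      simp [shiftDown, zeroBelow, tsub_eq_zero_of_le h]
    · have hne : (i : ℕ) ≠ j := fun e => hij (Fin.ext e)
      simp [shiftDown, zeroBelow, hi, show ¬ (i : ℕ) < j + 1 by omega]

/-- A function vanishing at the origin, precomposed with a downward shift, telescopes into
functions of the tails which are supported in the sub-cones. -/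
lemma scaledConverges_shiftFamily {m : ℕ}
    {L : ℝ≥0 → Measure (Fin (m + 1) → ℝ≥0∞)} [∀ t, IsProbabilityMeasure (L t)]
    {μ : (j : Fin (m + 1)) → Measure (Fin (m - (j : ℕ) + 1) → ℝ≥0∞)}
    (h : ∀ j, VagueCone m j L (μ j)) (f : C((Fin (m + 1) → ℝ≥0∞), ℝ)) (hf : f 0 = 0)
    {δ : ℝ≥0} (hδ : 0 < δ) : ScaledConverges L (shiftFamily f δ) := by
  let Z : ℕ → C((Fin (m + 1) → ℝ≥0∞), ℝ) := fun j =>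
    (shiftFamily f δ).comp ⟨zeroBelow j, continuous_zeroBelow j⟩
  have hZ : ∀ j x, Z j x = f (shiftDown δ (zeroBelow j x)) := fun _ _ => rfl
  have hsum : shiftFamily f δ = ∑ j : Fin (m + 1), (Z j - Z ((j : ℕ) + 1)) := by
    rw [Fin.sum_univ_eq_sum_range (fun j => Z j - Z (j + 1)), Finset.sum_range_sub']
    ext x
    have h0 : zeroBelow 0 x = x := by funext i; simp [zeroBelow]
    have h1 : shiftDown δ (zeroBelow (m + 1) x) = 0 := by
      funext i
      simp [shiftDown, zeroBelow, Nat.le_of_lt_succ i.isLt]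
    rw [ContinuousMap.sub_apply, hZ, hZ, h0, h1, hf, sub_zero, shiftFamily_apply]
  rw [hsum]
  refine ScaledConverges.sum _ fun j _ => ?_
  refine (h j).scaledConverges_of_zeroBelow _ (fun x => ?_) (a := δ) (by simpa) fun x hx => ?_
  · rw [ContinuousMap.sub_apply, ContinuousMap.sub_apply, hZ, hZ, hZ, hZ,
      zeroBelow_zeroBelow le_rfl, zeroBelow_zeroBelow (Nat.le_succ _)]
  · by_contra! hlt
    exact hx (by rw [ContinuousMap.sub_apply, hZ, hZ, shiftDown_zeroBelow_succ hlt.le, sub_self])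

lemma exists_tendsto_of_forall_approx {ι : Type*} {l : Filter ι} [l.NeBot] {u : ι → ℝ}
    (h : ∀ ε > 0, ∃ (v : ι → ℝ) (b : ℝ), Tendsto v l (𝓝 b) ∧ ∀ᶠ t in l, |u t - v t| ≤ ε) :
    ∃ b, Tendsto u l (𝓝 b) := by
  refine cauchy_map_iff_exists_tendsto.1 (Metric.cauchy_iff.2 ⟨inferInstance, fun ε hε => ?_⟩)
  obtain ⟨v, b, hv, huv⟩ := h (ε / 4) (by positivity)
  refine ⟨Metric.ball b (ε / 2), ?_, fun x hx y hy => ?_⟩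
  · rw [Filter.mem_map]
    filter_upwards [huv, hv.eventually (Metric.ball_mem_nhds b (show 0 < ε / 4 by positivity))]
      with t h1 h2
    rw [Set.mem_preimage, Metric.mem_ball, Real.dist_eq]
    rw [Real.dist_eq] at h2
    have := abs_add_le (u t - v t) (v t - b)
    rw [sub_add_sub_cancel] at this
    linarith
  · have := dist_triangle_right x y b
    rw [Metric.mem_ball] at hx hy
    linarith

/-- Vague convergence on all sub-cones implies convergence of the scaled expectations of all
continuous functions supported away from the origin. -/
lemma scaledConverges_of_vagueCone {m : ℕ}
    {L : ℝ≥0 → Measure (Fin (m + 1) → ℝ≥0∞)} [∀ t, IsProbabilityMeasure (L t)]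
    {μ : (j : Fin (m + 1)) → Measure (Fin (m - (j : ℕ) + 1) → ℝ≥0∞)}
    (h : ∀ j, VagueCone m j L (μ j)) (f : C((Fin (m + 1) → ℝ≥0∞), ℝ))
    {a : ℝ≥0∞} (ha : 0 < a) (hf : ∀ x, f x ≠ 0 → ∃ i, a ≤ x i) : ScaledConverges L f := by
  obtain ⟨b, hb, hba⟩ := exists_between ha
  have hf0 : f 0 = 0 := by
    by_contra h0
    obtain ⟨i, hi⟩ := hf 0 h0
    exact ha.not_ge hi
  let R : Fin (m + 1) → C((Fin (m + 1) → ℝ≥0∞), ℝ) := fun j => (ramp b).comp ⟨fun x => x j,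
    continuous_apply j⟩
  let Ψ := ∑ j, R j
  have hΨ : ScaledConverges L Ψ := ScaledConverges.sum _ fun j _ =>
    (h j).scaledConverges ((ramp b).comp ⟨fun x => x 0, continuous_apply 0⟩) hb
      fun x hx => le_of_ramp_ne_zero hx
  have hΨ0 : ∀ x, 0 ≤ Ψ x := fun x => by
    rw [ContinuousMap.sum_apply]
    exact Finset.sum_nonneg fun j _ => ramp_nonneg _ _
  have hΨa : ∀ x i, a ≤ x i → ramp b a ≤ Ψ x := fun x i hi => by
    rw [ContinuousMap.sum_apply]
    exact (ramp_mono b hi).trans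
      (Finset.single_le_sum (f := fun j => R j x) (fun j _ => ramp_nonneg _ _)
        (Finset.mem_univ i))
  obtain ⟨M, hM⟩ := hΨ
  have hc : 0 < ramp b a := ramp_pos hba
  have hM0 : 0 ≤ M := ge_of_tendsto' hM fun t =>
    mul_nonneg t.2 (integral_nonneg hΨ0)
  refine exists_tendsto_of_forall_approx fun ε hε => ?_
  have hlim : Tendsto (shiftFamily f) (𝓝[>] 0) (𝓝 f) := by
    have := (shiftFamily f).continuous.tendsto 0
    rw [shiftFamily_zero] at this
    exact this.mono_left nhdsWithin_le_nhds
  obtain ⟨δ, hδ, hδ0⟩ := ((hlim.eventually (Metric.ball_mem_nhds f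
    (show 0 < ε * ramp b a / (M + 1) by positivity))).and self_mem_nhdsWithin).exists
  have hnorm : ∀ x, |f x - shiftFamily f δ x| ≤ ε / (M + 1) * Ψ x := by
    intro x
    by_cases hx : ∃ i, a ≤ x i
    · obtain ⟨i, hi⟩ := hx
      have h1 : |f x - shiftFamily f δ x| ≤ ε * ramp b a / (M + 1) := by
        rw [← Real.dist_eq, dist_comm]
        exact ((ContinuousMap.dist_apply_le_dist x).trans_lt hδ).le
      refine h1.trans ?_
      rw [mul_div_right_comm]
      exact mul_le_mul_of_nonneg_left (hΨa x i hi) (by positivity)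
    · have h1 : f x = 0 := by_contra fun h0 => hx (hf x h0)
      have h2 : shiftFamily f δ x = 0 := by
        by_contra h0
        obtain ⟨i, hi⟩ := hf _ h0
        exact hx ⟨i, hi.trans tsub_le_self⟩
      rw [h1, h2, sub_zero, abs_zero]
      exact mul_nonneg (by positivity) (hΨ0 x)
  obtain ⟨l, hl⟩ := scaledConverges_shiftFamily h f hf0 hδ0
  refine ⟨_, l, hl, ?_⟩
  filter_upwards [hM.eventually (gt_mem_nhds (lt_add_one M))] with t ht
  rw [← mul_sub, ← integral_sub f.integrable_of_isFiniteMeasure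
    (shiftFamily f δ).integrable_of_isFiniteMeasure, abs_mul, abs_of_nonneg t.coe_nonneg]
  have h1 : |∫ x, (f x - shiftFamily f δ x) ∂(L t)| ≤ ε / (M + 1) * ∫ x, Ψ x ∂(L t) := by
    rw [← integral_const_mul]
    exact abs_integral_le_integral_abs.trans <| integral_mono
      (f - shiftFamily f δ).integrable_of_isFiniteMeasure.abs
      (Ψ.integrable_of_isFiniteMeasure.const_mul _) hnorm
  calc (t : ℝ) * |∫ x, (f x - shiftFamily f δ x) ∂(L t)|
      ≤ t * (ε / (M + 1) * ∫ x, Ψ x ∂(L t)) := mul_le_mul_of_nonneg_left h1 t.2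
    _ = ε / (M + 1) * (t * ∫ x, Ψ x ∂(L t)) := by ring
    _ ≤ ε / (M + 1) * (M + 1) := mul_le_mul_of_nonneg_left ht.le (by positivity)
    _ = ε := by field_simp

/-- The punctured space `[0,∞]^n \ {0}`. -/
abbrev puncturedCone (n : ℕ) : Set (Fin n → ℝ≥0∞) := {0}ᶜ

lemma isOpen_puncturedCone (n : ℕ) : IsOpen (puncturedCone n) := isOpen_compl_singleton

instance (n : ℕ) : LocallyCompactSpace (puncturedCone n) :=
  (isOpen_puncturedCone n).isOpenEmbedding_subtypeVal.locallyCompactSpace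

open scoped CompactlySupported

/-- Extension by zero of a compactly supported function on the punctured space. -/
def extendZero {n : ℕ} (f : C_c(puncturedCone n, ℝ)) : C((Fin n → ℝ≥0∞), ℝ) :=
  ⟨Function.extend Subtype.val f 0,
    f.hasCompactSupport.continuous_extend_zero (isOpen_puncturedCone n) f.continuous⟩

lemma extendZero_apply {n : ℕ} (f : C_c(puncturedCone n, ℝ)) (x : puncturedCone n) :
    extendZero f x = f x :=
  Subtype.val_injective.extend_apply _ _ _

lemma extendZero_zero {n : ℕ} (f : C_c(puncturedCone n, ℝ)) : extendZero f 0 = 0 :=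
  Function.extend_apply' _ _ _ fun ⟨x, hx⟩ => x.2 hx

lemma forall_puncturedCone {n : ℕ} {p : (Fin n → ℝ≥0∞) → Prop} (h0 : p 0)
    (h : ∀ x : puncturedCone n, p x) (x : Fin n → ℝ≥0∞) : p x := by
  by_cases hx : x = 0
  · exact hx ▸ h0
  · exact h ⟨x, hx⟩

lemma exists_le_coord_of_isCompact {n : ℕ} {K : Set (puncturedCone n)} (hK : IsCompact K) :
    ∃ a : ℝ≥0∞, 0 < a ∧ ∀ x ∈ K, ∃ i, a ≤ x.1 i := by
  rcases K.eq_empty_or_nonempty with rfl | hne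
  · exact ⟨1, one_pos, by simp⟩
  have hcont : Continuous fun x : puncturedCone n => Finset.univ.sup x.1 :=
    Continuous.finset_sup_apply fun i _ => (continuous_apply i).comp continuous_subtype_val
  obtain ⟨z, -, hz⟩ := hK.exists_isMinOn hne hcont.continuousOn
  have hpos : 0 < Finset.univ.sup z.1 := by
    obtain ⟨i, hi⟩ := Function.ne_iff.1 z.2
    exact Finset.lt_sup_iff.2 ⟨i, Finset.mem_univ i, pos_iff_ne_zero.2 hi⟩
  obtain ⟨a, ha, haz⟩ := exists_between hpos
  refine ⟨a, ha, fun x hx => ?_⟩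
  obtain ⟨i, -, hi⟩ := Finset.lt_sup_iff.1 (haz.trans_le (hz hx))
  exact ⟨i, hi.le⟩

lemma isCompact_preimage_exists_le_coord {n : ℕ} {a : ℝ≥0∞} (ha : 0 < a) :
    IsCompact ((↑) ⁻¹' {x : Fin n → ℝ≥0∞ | ∃ i, a ≤ x i} : Set (puncturedCone n)) := by
  have hcl : IsClosed {x : Fin n → ℝ≥0∞ | ∃ i, a ≤ x i} := by
    rw [Set.ofPred_exists]
    exact isClosed_iUnion_of_finite fun i => isClosed_le continuous_const (continuous_apply i)
  refine Topology.IsInducing.subtypeVal.isCompact_preimage' hcl.isCompact ?_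
  rintro x ⟨i, hi⟩
  rw [Subtype.range_coe]
  rintro rfl
  exact ha.not_ge hi

lemma exists_support_extendZero {n : ℕ} (f : C_c(puncturedCone n, ℝ)) :
    ∃ a : ℝ≥0∞, 0 < a ∧ ∀ x, extendZero f x ≠ 0 → ∃ i, a ≤ x i := by
  obtain ⟨a, ha, h⟩ := exists_le_coord_of_isCompact f.hasCompactSupport
  refine ⟨a, ha, forall_puncturedCone (fun h0 => absurd (extendZero_zero f) h0) fun x hx => ?_⟩
  rw [extendZero_apply] at hx
  exact h x (subset_tsupport _ hx)

/-- If the scaled expectations converge for all continuous functions supported away from the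
origin, the limit is given by a Radon measure on the punctured space. -/
lemma exists_vagueStar {m : ℕ} {L : ℝ≥0 → Measure (Fin (m + 1) → ℝ≥0∞)}
    [∀ t, IsProbabilityMeasure (L t)]
    (h : ∀ f : C((Fin (m + 1) → ℝ≥0∞), ℝ),
      (∃ a : ℝ≥0∞, 0 < a ∧ ∀ x, f x ≠ 0 → ∃ i, a ≤ x i) → ScaledConverges L f) :
    ∃ μ, RadonStar m μ ∧ VagueStar m L μ := by
  choose! Λ hΛ using h
  have hlim : ∀ f : C_c(puncturedCone (m + 1), ℝ), Tendsto
      (fun t : ℝ≥0 => (t : ℝ) * ∫ x, extendZero f x ∂(L t)) atTop (𝓝 (Λ (extendZero f))) :=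
    fun f => hΛ _ (exists_support_extendZero f)
  have hadd : ∀ f g : C_c(puncturedCone (m + 1), ℝ),
      ∀ x, extendZero (f + g) x = extendZero f x + extendZero g x := fun f g =>
    forall_puncturedCone (by simp [extendZero_zero]) fun x => by simp [extendZero_apply]
  have hsmul : ∀ (c : ℝ) (f : C_c(puncturedCone (m + 1), ℝ)),
      ∀ x, extendZero (c • f) x = c * extendZero f x := fun c f =>
    forall_puncturedCone (by simp [extendZero_zero]) fun x => by simp [extendZero_apply]
  let T : C_c(puncturedCone (m + 1), ℝ) →ₗ[ℝ] ℝ :=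
    { toFun := fun f => Λ (extendZero f)
      map_add' := fun f g => by
        refine tendsto_nhds_unique (hlim (f + g)) (((hlim f).add (hlim g)).congr fun t => ?_)
        simp_rw [hadd]
        rw [integral_add (extendZero f).integrable_of_isFiniteMeasure
          (extendZero g).integrable_of_isFiniteMeasure, mul_add]
      map_smul' := fun c f => by
        refine tendsto_nhds_unique (hlim (c • f)) (((hlim f).const_mul c).congr fun t => ?_)
        simp_rw [hsmul]
        rw [integral_const_mul]
        ring }
  let P : C_c(puncturedCone (m + 1), ℝ) →ₚ[ℝ] ℝ := PositiveLinearMap.mk₀ T fun f hf =>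
    ge_of_tendsto' (hlim f) fun t => mul_nonneg t.2 <| integral_nonneg <|
      forall_puncturedCone (extendZero_zero f).ge fun x => by
        simpa [extendZero_apply] using CompactlySupportedContinuousMap.le_def.1 hf x
  have hemb : MeasurableEmbedding ((↑) : puncturedCone (m + 1) → Fin (m + 1) → ℝ≥0∞) :=
    .subtype_coe (isOpen_puncturedCone _).measurableSet
  refine ⟨(RealRMK.rieszMeasure P).map (↑), ⟨?_, fun a ha => ?_⟩, fun f hf hs => ?_⟩
  · rw [hemb.map_apply]
    convert measure_empty (μ := RealRMK.rieszMeasure P)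
    ext x
    simpa using Function.ne_iff.1 x.2
  · rw [hemb.map_apply]
    exact (isCompact_preimage_exists_le_coord ha).measure_lt_top
  · obtain ⟨a, ha, hs⟩ := hs
    have hf0 : f 0 = 0 := by
      by_contra h0
      obtain ⟨i, hi⟩ := hs 0 h0
      exact ha.not_ge hi
    let g : C_c(puncturedCone (m + 1), ℝ) :=
      { toFun := fun x => f x
        continuous_toFun := by fun_prop
        hasCompactSupport' := HasCompactSupport.intro (isCompact_preimage_exists_le_coord ha)
          fun x hx => by_contra fun h0 => hx (hs x h0) }
    have hg : extendZero g = f := ContinuousMap.ext <|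
      forall_puncturedCone (by rw [extendZero_zero, hf0]) fun x => extendZero_apply g x
    have hint : ∫ x, f x ∂((RealRMK.rieszMeasure P).map (↑)) = Λ f := by
      rw [hemb.integral_map, ← hg]
      simp_rw [extendZero_apply]
      exact RealRMK.integral_rieszMeasure P g
    rw [hint]
    exact hΛ f ⟨a, ha, hs⟩

/-- Characterization of vague convergence on the cone `E*_m = [0,∞]^{m+1} \ {0}` of
`t P[Y_t ∈ ·]` in terms of vague convergence on the sub-cones
`E_{m-j} = (0,∞] × [0,∞]^{m-j}` of the laws of `(Y_{t,j},…,Y_{t,m})`, together with the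
relations between the limit measures and the finiteness property of the marginal
limits. -/
theorem mrv_cone_characterization (m : ℕ) (L : ℝ≥0 → Measure (Fin (m + 1) → ℝ≥0∞))
    (hL : ∀ t, IsProbabilityMeasure (L t)) :
    ((∃ μstar : Measure (Fin (m + 1) → ℝ≥0∞),
        μstar ≠ 0 ∧ RadonStar m μstar ∧ VagueStar m L μstar) ↔
      (∃ μ : (j : Fin (m + 1)) → Measure (Fin (m - (j : ℕ) + 1) → ℝ≥0∞),
        (∃ j, μ j ≠ 0) ∧
        ∀ j : Fin (m + 1), RadonCone (m - (j : ℕ)) (μ j) ∧ VagueCone m j L (μ j))) ∧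
    (∀ (μstar : Measure (Fin (m + 1) → ℝ≥0∞))
        (μ : (j : Fin (m + 1)) → Measure (Fin (m - (j : ℕ) + 1) → ℝ≥0∞)),
      μstar ≠ 0 → RadonStar m μstar → VagueStar m L μstar →
      (∀ j : Fin (m + 1), RadonCone (m - (j : ℕ)) (μ j) ∧ VagueCone m j L (μ j)) →
      ((∀ (j : Fin (m + 1)) (B : Set (Fin (m - (j : ℕ) + 1) → ℝ≥0∞)),
          MeasurableSet B → (∀ x ∈ B, 0 < x 0) →
          μ j B = μstar (projTail m j ⁻¹' B)) ∧
       (∀ x : Fin (m + 1) → ℝ≥0∞, (∃ i, 0 < x i) →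
          μstar {y | ¬ ∀ i, y i ≤ x i} =
            ∑ j : Fin (m + 1), μ j {y | x j < y 0 ∧
              ∀ i : Fin (m - (j : ℕ) + 1), (i : ℕ) ≠ 0 →
                y i ≤ x ⟨(j : ℕ) + (i : ℕ),
                  by have hj := j.isLt; have hi := i.isLt; omega⟩}) ∧
       (∀ j : Fin (m + 1), (j : ℕ) < m →
          ∀ A : Set (Fin (m - (j : ℕ)) → ℝ≥0∞),
            (∃ a : ℝ≥0∞, 0 < a ∧ ∀ y ∈ A, ∃ i, a ≤ y i) →
            μ j {y | 0 < y 0 ∧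
              (fun i : Fin (m - (j : ℕ)) => y ⟨(i : ℕ) + 1,
                by have hi := i.isLt; omega⟩) ∈ A} < ⊤))) := by
  refine ⟨⟨?_, ?_⟩, ?_⟩
  · rintro ⟨μ, h0, hμ, hv⟩
    exact ⟨fun j => tailMeasure m j μ, hμ.exists_tailMeasure_ne_zero h0,
      fun j => ⟨hμ.radonCone_tailMeasure j, hv.tendsto_projTail j⟩⟩
  · rintro ⟨μ, ⟨j, hj⟩, hμ⟩
    obtain ⟨ν, hν, hv⟩ := exists_vagueStar fun f ⟨a, ha, hf⟩ =>
      scaledConverges_of_vagueCone (fun j => (hμ j).2) f ha hf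
    refine ⟨ν, fun h0 => hj ?_, hν, hv⟩
    refine (hμ j).1.eq_zero fun f hf hs => ?_
    refine tendsto_nhds_unique ((hμ j).2 f hf hs) ?_
    have hlim := hv.tendsto_projTail j f hf hs
    rwa [integral_tailMeasure ν f hs, h0, integral_zero_measure] at hlim
  · intro ν μ _ hν hv hμ
    have key : ∀ (j : Fin (m + 1)) (B : Set (Fin (m - (j : ℕ) + 1) → ℝ≥0∞)),
        MeasurableSet B → (∀ x ∈ B, 0 < x 0) → μ j B = ν (projTail m j ⁻¹' B) :=
      fun j B hB hB0 => measure_eq_preimage_projTail hν hv (hμ j).1 (hμ j).2 hB hB0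
    refine ⟨key, fun x _ => ?_, fun j hj A ⟨a, ha, hA⟩ => ?_⟩
    · rw [measure_not_le_eq_sum]
      refine Finset.sum_congr rfl fun j _ => ?_
      exact (key j _ (measurableSet_lastExceed m x j) fun y hy =>
        zero_le.trans_lt hy.1).symm
    · have hmeas : MeasurableSet ({y | ∃ i, a ≤ y i} ∩ {y | 0 < y 0} :
          Set (Fin (m - (j : ℕ) + 1) → ℝ≥0∞)) :=
        (measurableSet_exists_le_coord a).inter (measurableSet_pos_coord 0)
      calc μ j _ ≤ μ j ({y | ∃ i, a ≤ y i} ∩ {y | 0 < y 0}) := by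
            refine measure_mono fun y hy => ⟨?_, hy.1⟩
            obtain ⟨i, hi⟩ := hA _ hy.2
            exact ⟨_, hi⟩
        _ = ν (projTail m j ⁻¹' ({y | ∃ i, a ≤ y i} ∩ {y | 0 < y 0})) :=
            key j _ hmeas fun y hy => hy.2
        _ ≤ ν {x | ∃ i, a ≤ x i} := by
            refine measure_mono fun x hx => ?_
            obtain ⟨i, hi⟩ := hx.1
            exact ⟨_, hi⟩
        _ < ⊤ := hν.2 a ha
end
end
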